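/- arXiv:1312.7453 — 12 statements merged into one kernel-verified Lean document; each statement's English description precedes it below -/
import Mathlib

section
/- Let p and q be primes with p > 3 and q > p³, and let G = (ℤ/pℤ)³ × ℤ/qℤ. Then G is a DCI-group; explicitly: for all subsets S, T ⊆ G, if there exists a bijection φ : G → G such that for all g, h ∈ G one has g·h⁻¹ ∈ S if and only if φ(g)·φ(h)⁻¹ ∈ T, then there exists a group automorphism μ of G with μ(S) = T. -/
section PrimeCyclic

variable {p : ℕ} [Fact p.Prime]

/-- A function on `ℤ/pℤ` with a nonzero period is constant. -/
theorem eq_of_period {Γ : Sort*} {X : ZMod p → Γ} {s : ZMod p} (hs : s ≠ 0)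
    (h : ∀ z, X (z + s) = X z) (z w : ZMod p) : X z = X w := by
  have key : ∀ (n : ℕ) z, X (z + n * s) = X z := by
    intro n
    induction n with
    | zero => simp
    | succ n ih =>
      intro z
      have : z + ((n + 1 : ℕ) : ZMod p) * s = (z + n * s) + s := by push_cast; ring
      rw [this, h, ih]
  have h1 := key ((w - z) / s).val z
  rw [ZMod.natCast_zmod_val, div_mul_cancel₀ _ hs] at h1
  rw [← h1]
  congr 1
  ring

/-- If all translates of `X` by the values of `δ` agree, then `X` is constant or `δ` is. -/
theorem eq_of_translates {Γ : Sort*} {ι : Type*} {X Y : ZMod p → Γ} {δ : ι → ZMod p}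
    (h : ∀ i z, X (z + δ i) = Y z) {i j : ι} (hij : δ i ≠ δ j) (z w : ZMod p) : X z = X w := by
  refine eq_of_period (sub_ne_zero.mpr hij) (fun z => ?_) z w
  have h1 := h i (z - δ j)
  have h2 := h j (z - δ j)
  rw [← h2] at h1
  rw [sub_add_cancel] at h1
  rw [← h1]
  congr 1
  ring

/-- If all translates of a nonconstant `X` by the values of `δ` agree, then `δ` is constant. -/
theorem shift_eq_of_translates {Γ : Sort*} {ι : Type*} {X Y : ZMod p → Γ} {δ : ι → ZMod p}
    (h : ∀ i z, X (z + δ i) = Y z) (hY : ¬ ∀ z w, Y z = Y w) (i j : ι) : δ i = δ j := by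
  by_contra hij
  refine hY fun z w => ?_
  rw [← h i z, ← h i w]
  exact eq_of_translates h hij _ _

theorem eq_linear_of_step {f : ZMod p → ZMod p} {a k : ZMod p} (ha : a ≠ 0)
    (h : ∀ x, f (x + a) - f x = k) (x : ZMod p) : f x = f 0 + k / a * x := by
  have := eq_of_period (X := fun x => f x - k / a * x) ha (fun z => ?_) x 0
  · simp only [mul_zero, sub_zero] at this
    rw [← this]; ring
  · have hk : k / a * a = k := div_mul_cancel₀ k ha
    linear_combination h z - hk

theorem eq_mul_of_additive {A : ZMod p → ZMod p} (h : ∀ x y, A (x + y) = A x + A y)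
    (x : ZMod p) : A x = A 1 * x := by
  have h0 : A 0 = 0 := by simpa using h 0 0
  have := eq_linear_of_step (f := A) (a := 1) (k := A 1) one_ne_zero
    (fun x => by rw [h]; ring) x
  simpa [h0] using this

theorem translate_smul_sub {Γ W : Type*} [AddCommGroup W] [Module (ZMod p) W]
    {X Y : W → Γ} {P : ZMod p → W} {a : ZMod p}
    (h : ∀ x w, X (w + (P (x + a) - P x)) = Y w) (w : W) :
    X (w + a • (P 1 - P 0)) = Y w := by
  by_cases ha : a = 0
  · subst ha
    simpa using h 0 w
  have inv : ∀ x w, X (w + (P (x + a) - P x - (P a - P 0))) = X w := by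
    intro x w
    have h1 := h x (w - (P a - P 0))
    have h2 := h 0 (w - (P a - P 0))
    rw [zero_add, sub_add_cancel] at h2
    rw [h2, ← h1]
    congr 1
    abel
  have path : ∀ (n : ℕ) w, X (w + (P (n * a) - P 0 - n • (P a - P 0))) = X w := by
    intro n
    induction n with
    | zero => simp
    | succ n ih =>
      intro w
      refine Eq.trans ?_ ((inv (n * a) _).trans (ih w))
      congr 1
      rw [succ_nsmul]
      push_cast
      rw [add_one_mul]
      abel
  have path' : ∀ (m n : ℕ) w, X (w + m • (P (n * a) - P 0 - n • (P a - P 0))) = X w := by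
    intro m n
    induction m with
    | zero => simp
    | succ m ih =>
      intro w
      rw [succ_nsmul, ← add_assoc, path, ih]
  have h1 := path' a.val (a⁻¹).val (w + (P a - P 0))
  rw [← Nat.cast_smul_eq_nsmul (ZMod p) a.val, ← Nat.cast_smul_eq_nsmul (ZMod p) (a⁻¹).val,
    ZMod.natCast_zmod_val, ZMod.natCast_zmod_val, inv_mul_cancel₀ ha, smul_sub, smul_smul,
    mul_inv_cancel₀ ha, one_smul] at h1
  have h2 := h 0 w
  rw [zero_add] at h2
  rw [← h2, ← h1]
  congr 1
  abel

end PrimeCyclic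

section Colourings

variable {p : ℕ} [Fact p.Prime]

theorem exists_linear_of_fibre_shift {Γ W : Type*} [AddCommGroup W] [Module (ZMod p) W]
    {S T : W → ZMod p → Γ} {g : W → ZMod p}
    (h : ∀ v d z, T d (z + (g (v + d) - g v)) = S d z) :
    ∃ l : W →ₗ[ZMod p] ZMod p, ∀ d z, T d (z + l d) = S d z := by
  let L : AddSubgroup W :=
    { carrier := {d | ∀ v, g (v + d) - g v = g d - g 0}
      zero_mem' := by simp
      add_mem' := by
        intro d e hd he v
        have h1 := he (v + d)
        have h2 := hd v
        have h3 := he d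
        rw [← add_assoc]
        linear_combination h1 + h2 - h3
      neg_mem' := by
        intro d hd v
        have h1 := hd (v + -d)
        have h2 := hd (-d)
        rw [neg_add_cancel_right] at h1
        rw [neg_add_cancel] at h2
        linear_combination h2 - h1 }
  let l₀ : L →+ ZMod p :=
    { toFun := fun d => g d - g 0
      map_zero' := by simp
      map_add' := by
        rintro ⟨d, hd⟩ ⟨e, he⟩
        have h3 := he d
        simp only [AddSubgroup.coe_add] at h3 ⊢
        linear_combination h3 }
  let L' : Submodule (ZMod p) W := AddSubgroup.toZModSubmodule p L
  let l₁ : L' →ₗ[ZMod p] ZMod p := AddMonoidHom.toZModLinearMap p l₀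
  obtain ⟨l, hl⟩ := LinearMap.exists_extend l₁
  refine ⟨l, fun d z => ?_⟩
  by_cases hd : ∀ z w, S d z = S d w
  · have hT : ∀ z w, T d z = T d w := by
      intro z w
      have h1 := h 0 d (z - (g (0 + d) - g 0))
      have h2 := h 0 d (w - (g (0 + d) - g 0))
      rw [sub_add_cancel] at h1 h2
      rw [h1, h2]
      exact hd _ _
    rw [← h 0 d z]
    exact hT _ _
  · have hdL : d ∈ L' := by
      intro v
      have := shift_eq_of_translates (fun v z => h v d z) hd v 0
      simpa using this
    have h1 : l d = g d - g 0 := by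
      exact LinearMap.congr_fun hl ⟨d, hdL⟩
    rw [h1, ← h 0 d z, zero_add]

/-- `S` is carried to `T` by a unitriangular linear map. -/
def UnitriangularEquiv {Γ : Type*} (S T : ZMod p → ZMod p → ZMod p → Γ) : Prop :=
  ∃ l m n : ZMod p, ∀ a b z, T a (b + l * a) (z + m * a + n * b) = S a b z

theorem unitriangularEquiv_of_affine_slope {Γ : Type*} {S T : ZMod p → ZMod p → ZMod p → Γ}
    {f h : ZMod p → ZMod p} {n : ZMod p}
    (hE : ∀ x a b z, T a (b + (f (x + a) - f x)) (z + (h (x + a) - h x) + n * b) = S a b z) :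
    UnitriangularEquiv S T := by
  refine ⟨f 1 - f 0, h 1 - h 0, n, fun a b z => ?_⟩
  have := translate_smul_sub (p := p) (W := ZMod p × ZMod p)
    (X := fun w => T a w.1 (w.2 + n * w.1)) (Y := fun w => S a w.1 w.2)
    (P := fun x => (f x, h x - n * f x)) (a := a) ?_ (b, z)
  · simp only [Prod.mk_sub_mk, Prod.smul_mk, smul_eq_mul, Prod.mk_add_mk] at this
    rw [← this]
    congr 1
    · ring
    · ring
  · rintro x ⟨b, z⟩
    simp only [Prod.mk_sub_mk, Prod.mk_add_mk]
    rw [← hE x a b z]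
    congr 1
    ring

theorem unitriangularEquiv_of_affine_base {Γ : Type*} {S T : ZMod p → ZMod p → ZMod p → Γ}
    {f : ZMod p → ZMod p} {g : ZMod p → ZMod p → ZMod p} {k : ZMod p}
    (hf : ∀ x, f x = f 0 + k * x)
    (hE : ∀ x y a b z,
      T a (b + (f (x + a) - f x)) (z + (g (x + a) (y + b) - g x y)) = S a b z) :
    UnitriangularEquiv S T := by
  obtain ⟨l, hl⟩ := exists_linear_of_fibre_shift (p := p) (W := ZMod p × ZMod p)
    (S := fun d z => S d.1 d.2 z) (T := fun d z => T d.1 (d.2 + k * d.1) z)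
    (g := fun v => g v.1 v.2) (by
      rintro ⟨x, y⟩ ⟨a, b⟩ z
      simp only [Prod.mk_add_mk]
      rw [← hE x y a b z, hf (x + a), hf x]
      congr 1
      ring)
  refine ⟨k, l (1, 0), l (0, 1), fun a b z => ?_⟩
  rw [← hl (a, b) z]
  have : l (a, b) = l (1, 0) * a + l (0, 1) * b := by
    have h : ((a, b) : ZMod p × ZMod p) = a • (1, 0) + b • (0, 1) := by simp
    rw [h, map_add, map_smul, map_smul]
    simp only [smul_eq_mul]
    ring
  rw [this, add_assoc]

/-- A triangular permutation carrying `S` to `T` can be replaced by a unitriangular linear map. -/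
theorem unitriangularEquiv_of_triangular {Γ : Type*} {S T : ZMod p → ZMod p → ZMod p → Γ}
    {f : ZMod p → ZMod p} {g : ZMod p → ZMod p → ZMod p}
    (hE : ∀ x y a b z,
      T a (b + (f (x + a) - f x)) (z + (g (x + a) (y + b) - g x y)) = S a b z) :
    UnitriangularEquiv S T := by
  by_cases hα : ∃ n : ZMod p, ∀ x y, g x y = g x 0 + n * y
  · obtain ⟨n, hn⟩ := hα
    refine unitriangularEquiv_of_affine_slope (f := f) (h := fun x => g x 0) (n := n) ?_
    intro x a b z
    rw [← hE x 0 a b z, hn (x + a) (0 + b), hn x 0]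
    congr 1
    ring
  by_cases hβ : ∃ k : ZMod p, ∀ x, f x = f 0 + k * x
  · obtain ⟨k, hk⟩ := hβ
    exact unitriangularEquiv_of_affine_base hk hE
  have hδ : ∀ a : ZMod p, a ≠ 0 → ∃ x, f (x + a) - f x ≠ f (0 + a) - f 0 := by
    intro a ha
    by_contra! hcon
    exact hβ ⟨_, eq_linear_of_step ha hcon⟩
  have hT : ∀ x a b, (∀ z w, S a b z = S a b w) ↔
      ∀ z w, T a (b + (f (x + a) - f x)) z = T a (b + (f (x + a) - f x)) w := by
    intro x a b
    constructor
    · intro h z w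
      have h1 := hE x 0 a b (z - (g (x + a) (0 + b) - g x 0))
      have h2 := hE x 0 a b (w - (g (x + a) (0 + b) - g x 0))
      rw [sub_add_cancel] at h1 h2
      rw [h1, h2]
      exact h _ _
    · intro h z w
      rw [← hE x 0 a b z, ← hE x 0 a b w]
      exact h _ _
  have hS0 : ∀ b, b ≠ 0 → ∀ z w, S 0 b z = S 0 b w := by
    intro b hb
    by_contra hK
    have key := shift_eq_of_translates (ι := ZMod p × ZMod p) (X := T 0 b) (Y := S 0 b)
      (δ := fun v => g v.1 (v.2 + b) - g v.1 v.2) (by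
        rintro ⟨x, y⟩ z
        simpa using hE x y 0 b z) hK
    exact hα ⟨_, fun x y => eq_linear_of_step hb (fun y => key (x, y) (0, 0)) y⟩
  have hSa : ∀ a, a ≠ 0 → ∀ b z w, S a b z = S a b w := by
    intro a ha
    obtain ⟨x₁, hx₁⟩ := hδ a ha
    have hconst := eq_of_translates (X := fun b => ∀ z w, T a b z = T a b w)
      (Y := fun b => ∀ z w, S a b z = S a b w) (δ := fun x => f (x + a) - f x)
      (fun x b => propext (hT x a b).symm) hx₁
    by_contra! hcon
    obtain ⟨b₀, z₀, w₀, h₀⟩ := hcon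
    have hfull : ∀ b, ¬ ∀ z w, S a b z = S a b w := by
      intro b hb
      rw [hT 0 a b] at hb
      have := (hconst (b + (f (0 + a) - f 0)) (b₀ + (f (0 + a) - f 0))).mp hb
      rw [← hT 0 a b₀] at this
      exact h₀ (this _ _)
    have hr : ∀ x y y' b, g (x + a) (y + b) - g x y = g (x + a) (y' + b) - g x y' := by
      intro x y y' b
      exact shift_eq_of_translates (fun y z => hE x y a b z) (hfull b) y y'
    have hstep : ∀ x y, g (x + a) y - g (x + a) 0 = g x y - g x 0 := by
      intro x y
      have := hr x y 0 0
      simp only [add_zero] at this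
      linear_combination this
    have hx : ∀ x y, g x y - g x 0 = g 0 y - g 0 0 := by
      intro x y
      exact eq_of_period (X := fun x => g x y - g x 0) ha (fun x => hstep x y) x 0
    have hadd : ∀ y b, g 0 (y + b) - g 0 0 = (g 0 y - g 0 0) + (g 0 b - g 0 0) := by
      intro y b
      have h1 := hr 0 y 0 b
      have h2 := hstep 0 (y + b)
      have h3 := hstep 0 b
      rw [zero_add b] at h1
      linear_combination h1 - h2 + h3
    refine hα ⟨g 0 1 - g 0 0, fun x y => ?_⟩
    have h1 := eq_mul_of_additive (A := fun y => g 0 y - g 0 0) hadd y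
    have h2 := hx x y
    linear_combination h1 + h2
  refine ⟨0, 0, 0, fun a b z => ?_⟩
  simp only [zero_mul, add_zero]
  by_cases ha : a = 0
  · subst ha
    by_cases hb : b = 0
    · subst hb
      simpa using hE 0 0 0 0 z
    · rw [← hE 0 0 0 b z]
      have := (hT 0 0 b).mp (hS0 b hb)
      simp only [add_zero, sub_self] at this ⊢
      exact this _ _
  · obtain ⟨x₁, hx₁⟩ := hδ a ha
    have hTz : ∀ b z w, T a b z = T a b w := by
      intro b z w
      have := (hT 0 a (b - (f (0 + a) - f 0))).mp (hSa a ha _)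
      rw [sub_add_cancel] at this
      exact this z w
    have hb := eq_of_translates (X := fun b => T a b 0)
      (Y := fun b => S a b 0) (δ := fun x => f (x + a) - f x)
      (fun x b => by rw [hSa a ha b 0 0, ← hE x 0 a b 0]; exact hTz _ _ _) hx₁
    rw [← hE 0 0 a b z]
    exact (hTz _ _ _).trans ((hb _ _).trans (hTz _ _ _))

end Colourings

section Twisted

variable {p : ℕ} [Fact p.Prime]

theorem UnitriangularEquiv.of_shear {Γ : Type*} {S T : ZMod p → ZMod p → ZMod p → Γ}
    (r s : ZMod p)
    (h : UnitriangularEquiv (fun a b z => S a (b + r * a) z) (fun a b z => T a (b + s * a) z)) :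
    UnitriangularEquiv S T := by
  obtain ⟨l, m, n, h⟩ := h
  refine ⟨l + s - r, m - n * r, n, fun a b z => ?_⟩
  have := h a (b - r * a) z
  beta_reduce at this
  rw [sub_add_cancel] at this
  rw [← this]
  congr 1 <;> ring

variable {C Γ : Type*} [Group C] [MulAction C Γ]

theorem const_of_smul_shift {X Y : ZMod p → Γ} {s : ZMod p} {u : C}
    (h : ∀ z, X (z + s) = u • Y z) (hY : ∀ z w, Y z = Y w) (z w : ZMod p) : X z = X w := by
  have h1 := h (z - s)
  have h2 := h (w - s)
  rw [sub_add_cancel] at h1 h2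
  rw [h1, h2, hY]

theorem unitriangularEquiv_of_twist_second {S T : ZMod p → ZMod p → ZMod p → Γ}
    {g : ZMod p → ZMod p → ZMod p} {k : ZMod p → C} (hk : k 0 = 1)
    (hE : ∀ x y a b z, T a b (z + (g (x + a) (y + b) - g x y)) = k y • S a b z)
    (hfix : ∀ a b z, b ≠ 0 → ∀ u : C, u • S a b z = S a b z)
    {a₀ y₀ z₀ : ZMod p} (hne : k y₀ • S a₀ 0 z₀ ≠ S a₀ 0 z₀) :
    UnitriangularEquiv S T := by
  have ha : a₀ ≠ 0 := by
    rintro rfl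
    have h1 := hE 0 y₀ 0 0 z₀
    have h2 := hE 0 0 0 0 z₀
    simp only [add_zero, sub_self, hk, one_smul] at h1 h2
    exact hne (h1.symm.trans h2)
  have hT : ¬ ∀ z w, T a₀ 0 z = T a₀ 0 w := by
    intro hc
    apply hne
    rw [← hE 0 y₀ a₀ 0 z₀]
    have h2 := hE 0 0 a₀ 0 z₀
    rw [hk, one_smul] at h2
    rw [← h2]
    exact hc _ _
  have hS : ∀ y, ¬ ∀ z w, k y • S a₀ 0 z = k y • S a₀ 0 w := by
    intro y hc
    exact hT (const_of_smul_shift (u := (1 : C)) (Y := fun z => k y • S a₀ 0 z)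
      (fun z => by rw [one_smul]; exact hE 0 y a₀ 0 z) hc)
  obtain ⟨lam, hlam⟩ : ∃ lam : ZMod p → ZMod p, ∀ x y, g x y = g 0 y + lam y * x := by
    refine ⟨fun y => (g (0 + a₀) y - g 0 y) / a₀, fun x y => ?_⟩
    refine eq_linear_of_step (f := fun x => g x y) ha (fun x => ?_) x
    have := shift_eq_of_translates (X := T a₀ 0) (δ := fun x => g (x + a₀) (y + 0) - g x y)
      (fun x z => hE x y a₀ 0 z) (hS y) x 0
    simpa using this
  have hlamne : lam y₀ ≠ lam 0 := by
    intro he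
    apply hne
    have h1 := hE 0 y₀ a₀ 0 z₀
    have h2 := hE 0 0 a₀ 0 z₀
    rw [hk, one_smul] at h2
    rw [← h1, ← h2, add_zero, hlam (0 + a₀) y₀, he, hlam 0 y₀, add_zero, hlam (0 + a₀) 0]
    congr 1
    ring
  refine ⟨0, lam 0, 0, fun a b z => ?_⟩
  simp only [zero_mul, add_zero]
  by_cases hb : b = 0
  · subst hb
    have h2 := hE 0 0 a 0 z
    rw [hk, one_smul] at h2
    rw [← h2, add_zero, hlam (0 + a) 0]
    congr 1
    ring
  · obtain ⟨y, hy⟩ : ∃ y, lam (y + b) ≠ lam y := by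
      by_contra! hcon
      exact hlamne (eq_of_period hb hcon _ _)
    have hTc := eq_of_translates (X := T a b) (Y := S a b)
      (δ := fun x => g (x + a) (y + b) - g x y)
      (fun x z => by rw [hE x y a b z, hfix a b z hb]) (i := 1) (j := 0) (by
        intro he
        apply hy
        rw [hlam (1 + a), hlam 1, hlam (0 + a), hlam 0 y] at he
        linear_combination he)
    rw [← hfix a b z hb (k 0), ← hE 0 0 a b z]
    exact hTc _ _

theorem unitriangularEquiv_of_twist_first {S T : ZMod p → ZMod p → ZMod p → Γ}
    {f : ZMod p → ZMod p} {g : ZMod p → ZMod p → ZMod p} {k : ZMod p → C} (hk : k 0 = 1)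
    (hE : ∀ x y a b z,
      T a (b + (f (x + a) - f x)) (z + (g (x + a) (y + b) - g x y)) = k x • S a b z)
    (hfix : ∀ a b z, a ≠ 0 → ∀ u : C, u • S a b z = S a b z)
    {b₀ x₀ z₀ : ZMod p} (hne : k x₀ • S 0 b₀ z₀ ≠ S 0 b₀ z₀) :
    UnitriangularEquiv S T := by
  have hE0 : ∀ x y b z, T 0 b (z + (g x (y + b) - g x y)) = k x • S 0 b z := by
    intro x y b z
    have := hE x y 0 b z
    simpa using this
  have hb : b₀ ≠ 0 := by
    rintro rfl
    have h1 := hE0 x₀ 0 0 z₀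
    have h2 := hE0 0 0 0 z₀
    simp only [add_zero, sub_self, hk, one_smul] at h1 h2
    exact hne (h1.symm.trans h2)
  have hT : ¬ ∀ z w, T 0 b₀ z = T 0 b₀ w := by
    intro hc
    apply hne
    have h2 := hE0 0 0 b₀ z₀
    rw [hk, one_smul] at h2
    rw [← hE0 x₀ 0 b₀ z₀, ← h2]
    exact hc _ _
  have hS : ∀ x, ¬ ∀ z w, k x • S 0 b₀ z = k x • S 0 b₀ w := by
    intro x hc
    exact hT (const_of_smul_shift (u := (1 : C)) (Y := fun z => k x • S 0 b₀ z)
      (fun z => by rw [one_smul]; exact hE0 x 0 b₀ z) hc)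
  obtain ⟨lam, hlam⟩ : ∃ lam : ZMod p → ZMod p, ∀ x y, g x y = g x 0 + lam x * y := by
    refine ⟨fun x => (g x (0 + b₀) - g x 0) / b₀, fun x y => ?_⟩
    refine eq_linear_of_step (f := fun y => g x y) hb (fun y => ?_) y
    exact shift_eq_of_translates (X := T 0 b₀) (δ := fun y => g x (y + b₀) - g x y)
      (fun y z => hE0 x y b₀ z) (hS x) y 0
  have hlamne : lam x₀ ≠ lam 0 := by
    intro he
    apply hne
    have h1 := hE0 x₀ 0 b₀ z₀
    have h2 := hE0 0 0 b₀ z₀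
    rw [hk, one_smul] at h2
    rw [← h1, ← h2, hlam x₀ (0 + b₀), he, hlam 0 (0 + b₀)]
    congr 1
    ring
  refine ⟨f 1 - f 0, 0, lam 0, fun a b z => ?_⟩
  by_cases ha : a = 0
  · subst ha
    have h2 := hE0 0 0 b z
    rw [hk, one_smul] at h2
    rw [← h2, hlam 0 (0 + b)]
    congr 1 <;> ring
  · obtain ⟨x, hx⟩ : ∃ x, lam (x + a) ≠ lam x := by
      by_contra! hcon
      exact hlamne (eq_of_period ha hcon _ _)
    have hSc : ∀ b z w, S a b z = S a b w := by
      intro b z w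
      have h1 := eq_of_translates (X := T a (b + (f (x + a) - f x))) (Y := S a b)
        (δ := fun y => g (x + a) (y + b) - g x y)
        (fun y z => by rw [hE x y a b z, hfix a b z ha]) (i := 1) (j := 0) (by
          intro he
          apply hx
          rw [hlam (x + a) (1 + b), hlam x 1, hlam (x + a) (0 + b), hlam x 0] at he
          linear_combination he)
      rw [← hfix a b z ha (k x), ← hfix a b w ha (k x), ← hE x 0, ← hE x 0]
      exact h1 _ _
    have hTc : ∀ b z w, T a b z = T a b w := by
      intro b
      have h1 := fun z => hE x 0 a (b - (f (x + a) - f x)) z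
      rw [sub_add_cancel] at h1
      exact const_of_smul_shift h1 (hSc _)
    have h1 := translate_smul_sub (X := fun b => T a b 0) (Y := fun b => S a b 0) (P := f) (a := a)
      (fun x b => by
        rw [← hfix a b 0 ha (k x), ← hE x 0]
        exact hTc _ _ _) b
    simp only [smul_eq_mul] at h1
    rw [hTc _ _ 0, hSc _ _ 0, ← h1, mul_comm]

theorem unitriangularEquiv_of_twist {S T : ZMod p → ZMod p → ZMod p → Γ}
    {f : ZMod p → ZMod p} {g : ZMod p → ZMod p → ZMod p} {k : ZMod p → ZMod p → C}
    (hk : k 0 0 = 1)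
    (hE : ∀ x y a b z,
      T a (b + (f (x + a) - f x)) (z + (g (x + a) (y + b) - g x y)) = k x y • S a b z)
    (hP : ∀ a b, (∀ z (u : C), u • S a b z = S a b z) ∨
      ∀ x y a' b' z', k (x + a) (y + b) • S a' b' z' = k x y • S a' b' z') :
    UnitriangularEquiv S T := by
  by_cases htriv : ∀ x y a b z, k x y • S a b z = S a b z
  · refine unitriangularEquiv_of_triangular (f := f) (g := g) ?_
    intro x y a b z
    rw [hE, htriv]
  push Not at htriv
  obtain ⟨x₀, y₀, a₀, b₀, z₀, hne⟩ := htriv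
  -- the twist regarded as a family of colourings
  set K : ZMod p → ZMod p → ZMod p → ZMod p → ZMod p → Γ :=
    fun x y a b z => k x y • S a b z with hKdef
  have hK1 : ∀ {x y}, K x y = K 0 0 → ∀ a b z, k x y • S a b z = S a b z := by
    intro x y h a b z
    have := congrFun (congrFun (congrFun h a) b) z
    simpa [hKdef, hk] using this
  have hPK : ∀ {a b}, (∃ z, ∃ u : C, u • S a b z ≠ S a b z) →
      ∀ x y, K (x + a) (y + b) = K x y := by
    rintro a b ⟨z, u, hu⟩ x y
    rcases hP a b with h | h
    · exact absurd (h z u) hu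
    · funext a' b' z'
      exact h x y a' b' z'
  have hper := hPK ⟨z₀, _, hne⟩
  have hfixed : ∀ {a b}, ¬ (∀ x y, K (x + a) (y + b) = K x y) →
      ∀ z (u : C), u • S a b z = S a b z := by
    intro a b h z u
    by_contra hcon
    exact h (hPK ⟨z, u, hcon⟩)
  by_cases ha : a₀ = 0
  · subst ha
    simp only [add_zero] at hper
    have hb : b₀ ≠ 0 := by
      rintro rfl
      have h1 := hE x₀ y₀ 0 0 z₀
      have h2 := hE 0 0 0 0 z₀
      simp only [add_zero, sub_self, hk, one_smul] at h1 h2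
      exact hne (h1.symm.trans h2)
    have hK0 : ∀ x y, K x y = K x 0 := fun x y => eq_of_period hb (hper x) y 0
    have hK0' : ∀ x y a b z, k x y • S a b z = k x 0 • S a b z := fun x y a b z =>
      congrFun (congrFun (congrFun (hK0 x y) a) b) z
    refine unitriangularEquiv_of_twist_first (k := fun x => k x 0) (f := f) (g := g) hk ?_ ?_
      (b₀ := b₀) (x₀ := x₀) (z₀ := z₀) ?_
    · intro x y a b z
      rw [hE, hK0']
    · intro a b z ha
      refine hfixed (fun h => hne ?_) z
      refine hK1 ?_ _ _ _
      rw [hK0 x₀]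
      refine eq_of_period (X := fun x => K x 0) ha (fun x => ?_) x₀ 0
      rw [← h x 0, hK0 _ (0 + b)]
    · rw [← hK0' x₀ y₀]
      exact hne
  · obtain ⟨φ, hφ⟩ : ∃ φ, ∀ x, f x = f 0 + φ * x := by
      by_contra hnot
      have hδ : ∃ x, f (x + a₀) - f x ≠ f (0 + a₀) - f 0 := by
        by_contra! hcon
        exact hnot ⟨_, eq_linear_of_step ha hcon⟩
      obtain ⟨x₁, hx₁⟩ := hδ
      have hTS : ∀ x b, (∃ z, ∃ u : C, u • T a₀ (b + (f (x + a₀) - f x)) z ≠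
          T a₀ (b + (f (x + a₀) - f x)) z) ↔ ∃ z, ∃ u : C, u • S a₀ b z ≠ S a₀ b z := by
        intro x b
        constructor
        · rintro ⟨z, u, hu⟩
          refine ⟨z - (g (x + a₀) (0 + b) - g x 0), (k x 0)⁻¹ * u * k x 0, fun he => hu ?_⟩
          have h1 := hE x 0 a₀ b (z - (g (x + a₀) (0 + b) - g x 0))
          rw [sub_add_cancel] at h1
          rw [h1]
          rw [mul_assoc, mul_smul, inv_smul_eq_iff, mul_smul] at he
          exact he
        · rintro ⟨z, u, hu⟩
          refine ⟨z + (g (x + a₀) (0 + b) - g x 0), k x 0 * u * (k x 0)⁻¹, fun he => hu ?_⟩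
          rw [hE x 0 a₀ b z, smul_smul, inv_mul_cancel_right, mul_smul, smul_left_cancel_iff] at he
          exact he
      have hall : ∀ b, ∃ z, ∃ u : C, u • S a₀ b z ≠ S a₀ b z := by
        intro b
        rw [← hTS 0]
        rw [eq_of_translates (X := fun b => ∃ z, ∃ u : C, u • T a₀ b z ≠ T a₀ b z)
          (Y := fun b => ∃ z, ∃ u : C, u • S a₀ b z ≠ S a₀ b z)
          (δ := fun x => f (x + a₀) - f x) (fun x b => propext (hTS x b)) hx₁ _
            (b₀ + (f (0 + a₀) - f 0)), hTS]
        exact ⟨z₀, _, hne⟩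
      have hy : ∀ x y, K x y = K x 0 := by
        intro x y
        rw [← hPK (hall 0) x y, ← hPK (hall y) x 0, zero_add, add_zero]
      refine hne (hK1 ?_ _ _ _)
      rw [hy x₀]
      refine eq_of_period (X := fun x => K x 0) ha (fun x => ?_) x₀ 0
      rw [← hper x 0, hy _ (0 + b₀)]
    set r := b₀ / a₀ with hr
    have hra : r * a₀ = b₀ := div_mul_cancel₀ b₀ ha
    have hKr : ∀ x y, K x (y + r * x) = K 0 y := by
      intro x y
      have := eq_of_period (X := fun x => K x (y + r * x)) ha (fun x => by
        have h1 := hper x (y + r * x)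
        rw [← h1]
        congr 1
        rw [← hra]; ring) x 0
      simpa using this
    have hKr' : ∀ x y a b z, k x (y + r * x) • S a b z = k 0 y • S a b z := fun x y a b z =>
      congrFun (congrFun (congrFun (hKr x y) a) b) z
    refine UnitriangularEquiv.of_shear r (r + φ) ?_
    refine unitriangularEquiv_of_twist_second (k := fun y => k 0 y)
      (g := fun x y => g x (y + r * x)) hk ?_ ?_ (a₀ := a₀) (y₀ := y₀ - r * x₀) (z₀ := z₀) ?_
    · intro x y a b z
      rw [← hKr' x y, ← hE, hφ (x + a), hφ x]
      congr 1
      · ring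
      · have : y + r * x + (b + r * a) = y + b + r * (x + a) := by ring
        rw [this]
    · intro a b z hb
      refine hfixed (fun h => hne ?_) z
      refine hK1 ?_ _ _ _
      rw [← sub_add_cancel y₀ (r * x₀), hKr]
      refine eq_of_period (X := fun y => K 0 y) hb (fun y => ?_) _ 0
      have := h 0 y
      rw [zero_add, show y + (b + r * a) = y + b + r * a by ring, hKr] at this
      exact this
    · rw [← hKr' x₀, zero_add, hra, sub_add_cancel]
      exact hne

end Twisted

section Flags

variable {p : ℕ}

/-- Some `p`-group of permutations contains all translations and their conjugates by `ψ`. -/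
def JoinsInPGroup (p : ℕ) {V : Type*} [AddCommGroup V] (ψ : Equiv.Perm V) : Prop :=
  ∃ P : Subgroup (Equiv.Perm V), IsPGroup p P ∧
    ∀ u, Equiv.addRight u ∈ P ∧ ψ⁻¹ * Equiv.addRight u * ψ ∈ P

theorem JoinsInPGroup.of_action {V P : Type*} [AddCommGroup V] [Group P] [MulAction P V]
    {ψ : Equiv.Perm V} (hP : IsPGroup p P) (h₁ : ∀ u : V, ∃ g : P, ∀ v : V, g • v = v + u)
    (h₂ : ∀ u : V, ∃ g : P, ∀ v : V, ψ (g • v) = ψ v + u) : JoinsInPGroup p ψ := by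
  refine ⟨(MulAction.toPermHom P V).range,
    hP.of_surjective _ (MulAction.toPermHom P V).rangeRestrict_surjective, fun u => ⟨?_, ?_⟩⟩
  · obtain ⟨g, hg⟩ := h₁ u
    exact ⟨g, Equiv.ext fun v => hg v⟩
  · obtain ⟨g, hg⟩ := h₂ u
    refine ⟨g, Equiv.ext fun v => ?_⟩
    rw [Equiv.Perm.mul_apply, Equiv.Perm.mul_apply, Equiv.Perm.eq_inv_iff_eq]
    exact hg v

variable [Fact p.Prime]

theorem JoinsInPGroup.exists_central {V : Type*} [AddCommGroup V] [Finite V] [Nontrivial V]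
    {ψ : Equiv.Perm V} (h : JoinsInPGroup p ψ) :
    ∃ P : Subgroup (Equiv.Perm V), IsPGroup p P ∧
      (∀ u, Equiv.addRight u ∈ P ∧ ψ⁻¹ * Equiv.addRight u * ψ ∈ P) ∧
      ∃ z z' : V, z ≠ 0 ∧ z' ≠ 0 ∧ (∀ g ∈ P, ∀ v, g (v + z) = g v + z) ∧
        ∀ v, ψ (v + z) = ψ v + z' := by
  obtain ⟨P, hP, hu⟩ := h
  refine ⟨P, hP, hu, ?_⟩
  have hnt : Nontrivial P := by
    obtain ⟨u, hu0⟩ := exists_ne (0 : V)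
    refine ⟨⟨⟨_, (hu u).1⟩, 1, fun he => hu0 ?_⟩⟩
    have := congrArg (fun σ : P => (σ : Equiv.Perm V) 0) he
    simpa using this
  have hc := hP.center_nontrivial
  obtain ⟨⟨⟨ζ, hζP⟩, hζ⟩, hζ1⟩ := exists_ne (1 : Subgroup.center P)
  have hcomm : ∀ g ∈ P, g * ζ = ζ * g := by
    intro g hg
    have := Subgroup.mem_center_iff.mp hζ ⟨g, hg⟩
    exact congrArg Subtype.val this
  have htr : ∀ v, ζ v = v + ζ 0 := by
    intro v
    have := congrArg (fun σ : Equiv.Perm V => σ 0) (hcomm _ (hu v).1)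
    simp only [Equiv.Perm.mul_apply, Equiv.coe_addRight, zero_add] at this
    rw [← this, add_comm]
  have hψ : ∀ v, ψ (v + ζ 0) = ψ v + (ψ (ψ⁻¹ 0 + ζ 0)) := by
    intro v
    have := congrArg (fun σ : Equiv.Perm V => ψ (σ (ψ⁻¹ 0))) (hcomm _ (hu (ψ v)).2)
    have h₁ : ∀ w, ψ (ψ⁻¹ w) = w := ψ.apply_symm_apply
    have h₂ : ∀ w, ψ⁻¹ (ψ w) = w := ψ.symm_apply_apply
    simp only [Equiv.Perm.mul_apply, Equiv.coe_addRight, h₁, h₂, zero_add] at this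
    rw [htr v, htr (ψ⁻¹ 0)] at this
    rw [← this, add_comm]
  have hz : ζ 0 ≠ 0 := by
    intro h0
    apply hζ1
    refine Subtype.ext (Subtype.ext (Equiv.ext fun v => ?_))
    change ζ v = v
    rw [htr, h0, add_zero]
  refine ⟨ζ 0, _, hz, ?_, ?_, hψ⟩
  · intro h0
    apply hz
    have := hψ 0
    rw [h0, add_zero, zero_add] at this
    exact ψ.injective this
  · intro g hg v
    have := congrArg (fun σ : Equiv.Perm V => σ v) (hcomm g hg)
    simp only [Equiv.Perm.mul_apply] at this
    rw [← htr v, this, htr]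

theorem map_add_smul_of_map_add {V V' : Type*} [AddCommGroup V] [Module (ZMod p) V]
    [AddCommGroup V'] [Module (ZMod p) V'] {ψ : V → V'} {z : V} {z' : V'}
    (h : ∀ v, ψ (v + z) = ψ v + z') (t : ZMod p) (v : V) : ψ (v + t • z) = ψ v + t • z' := by
  have key : ∀ (n : ℕ) v, ψ (v + n • z) = ψ v + n • z' := by
    intro n
    induction n with
    | zero => simp
    | succ n ih =>
      intro v
      rw [succ_nsmul, ← add_assoc, h, ih, succ_nsmul, add_assoc]
  have := key t.val v
  rwa [← Nat.cast_smul_eq_nsmul (ZMod p), ← Nat.cast_smul_eq_nsmul (ZMod p),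
    ZMod.natCast_zmod_val] at this

theorem exists_linearEquiv_apply_eq {K V : Type*} [Field K] [AddCommGroup V] [Module K V]
    {x y : V} (hx : x ≠ 0) (hy : y ≠ 0) : ∃ e : V ≃ₗ[K] V, e x = y := by
  obtain ⟨e, he⟩ := Submodule.exists_linearEquiv_restrict_eq
    ((LinearEquiv.toSpanNonzeroSingleton K V x hx).symm.trans
      (LinearEquiv.toSpanNonzeroSingleton K V y hy))
  refine ⟨e, ?_⟩
  have := he ⟨x, Submodule.mem_span_singleton_self x⟩
  rw [← this, LinearEquiv.trans_apply, ← LinearEquiv.toSpanNonzeroSingleton_one K V x hx,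
    LinearEquiv.symm_apply_apply, LinearEquiv.toSpanNonzeroSingleton_one]

theorem JoinsInPGroup.exists_quotient {V W : Type*} [AddCommGroup V] [Module (ZMod p) V]
    [AddCommGroup W] [Module (ZMod p) W] [Finite W] (e : (W × ZMod p) ≃ₗ[ZMod p] V)
    {ψ : Equiv.Perm V} (h : JoinsInPGroup p ψ) :
    ∃ (A B : (W × ZMod p) ≃ₗ[ZMod p] V) (ψ' : Equiv.Perm W) (g : W → ZMod p),
      JoinsInPGroup p ψ' ∧ ∀ w s, ψ (A (w, s)) = B (ψ' w, s + g w) := by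
  have : Finite V := Finite.of_equiv _ e.toEquiv
  have : Nontrivial V := e.symm.toEquiv.nontrivial
  obtain ⟨P, hP, hu, z, z', hz, hz', hPz, hψ⟩ := h.exists_central
  have he : e (0, 1) ≠ 0 := by simp
  obtain ⟨α, hα⟩ := exists_linearEquiv_apply_eq (K := ZMod p) he hz
  obtain ⟨β, hβ⟩ := exists_linearEquiv_apply_eq (K := ZMod p) he hz'
  set A := e.trans α
  set B := e.trans β
  have hsplit : ∀ (w : W) (s t : ZMod p),
      ((w, s + t) : W × ZMod p) = (w, s) + t • ((0, 1) : W × ZMod p) := by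
    intro w s t; simp
  have hA : ∀ w s t, A (w, s + t) = A (w, s) + t • z := by
    intro w s t
    rw [hsplit, map_add, map_smul, ← hα]
    rfl
  have hB : ∀ w s t, B (w, s + t) = B (w, s) + t • z' := by
    intro w s t
    rw [hsplit, map_add, map_smul, ← hβ]
    rfl
  have hψA : ∀ w s, ψ (A (w, s)) = B ((B.symm (ψ (A (w, 0)))).1,
      s + (B.symm (ψ (A (w, 0)))).2) := by
    intro w s
    rw [add_comm s, hB, Prod.mk.eta, LinearEquiv.apply_symm_apply,
      ← map_add_smul_of_map_add hψ, ← hA, zero_add]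
  have hinj : Function.Injective fun w => (B.symm (ψ (A (w, 0)))).1 := by
    intro w₁ w₂ h12
    have h1 := hψA w₁ 0
    have h2 := hψA w₂ ((B.symm (ψ (A (w₁, 0)))).2 - (B.symm (ψ (A (w₂, 0)))).2)
    rw [sub_add_cancel] at h2
    simp only at h12
    rw [zero_add, h12, ← h2] at h1
    exact congrArg Prod.fst (A.injective (ψ.injective h1))
  let ψ' : Equiv.Perm W := Equiv.ofBijective _ (Finite.injective_iff_bijective.mp hinj)
  refine ⟨A, B, ψ', fun w => (B.symm (ψ (A (w, 0)))).2, ?_, hψA⟩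
  have hPA : ∀ g ∈ P, ∀ w s, (A.symm (g (A (w, s)))).1 = (A.symm (g (A (w, 0)))).1 := by
    intro g hg w s
    have h1 := map_add_smul_of_map_add (hPz g hg) s (A (w, 0))
    rw [← hA, zero_add] at h1
    rw [h1, map_add, map_smul, ← hα]
    have : A.symm (α (e (0, 1))) = (0, 1) := A.symm_apply_apply (0, 1)
    simp [this]
  let act : MulAction P W :=
    { smul := fun g w => (A.symm ((g : Equiv.Perm V) (A (w, 0)))).1
      one_smul := by
        intro w
        change (A.symm ((1 : Equiv.Perm V) (A (w, 0)))).1 = w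
        simp
      mul_smul := by
        intro g g' w
        change (A.symm ((g : Equiv.Perm V) ((g' : Equiv.Perm V) (A (w, 0))))).1 =
          (A.symm ((g : Equiv.Perm V) (A ((A.symm ((g' : Equiv.Perm V) (A (w, 0)))).1, 0)))).1
        rw [← hPA g g.2 _ (A.symm ((g' : Equiv.Perm V) (A (w, 0)))).2, Prod.mk.eta,
          LinearEquiv.apply_symm_apply] }
  have hact : ∀ (g : P) (w : W), g • w = (A.symm ((g : Equiv.Perm V) (A (w, 0)))).1 :=
    fun _ _ => rfl
  refine JoinsInPGroup.of_action hP (fun u => ⟨⟨_, (hu (A (u, 0))).1⟩, fun w => ?_⟩)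
    (fun u => ⟨⟨_, (hu (B (u, 0))).2⟩, fun w => ?_⟩)
  · rw [hact]
    simp
  · rw [hact]
    set v := A.symm ((ψ⁻¹ * Equiv.addRight (B (u, 0)) * ψ) (A (w, 0))) with hv
    have h1 : ψ (A (v.1, v.2)) = ψ (A (w, 0)) + B (u, 0) := by
      rw [Prod.mk.eta, hv, LinearEquiv.apply_symm_apply]
      simp
    rw [hψA v.1 v.2, hψA w 0, ← map_add, Prod.mk_add_mk] at h1
    exact congrArg Prod.fst (B.injective h1)

/-- In suitable bases, a permutation of a three-dimensional space joining the translations to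
their conjugates in a `p`-group is triangular. -/
theorem JoinsInPGroup.exists_triangular {V : Type*} [AddCommGroup V] [Module (ZMod p) V]
    (e : ((ZMod p × ZMod p) × ZMod p) ≃ₗ[ZMod p] V) {ψ : Equiv.Perm V}
    (h : JoinsInPGroup p ψ) :
    ∃ (A B : ((ZMod p × ZMod p) × ZMod p) ≃ₗ[ZMod p] V) (k : ZMod p) (f : ZMod p → ZMod p)
      (g : ZMod p → ZMod p → ZMod p),
      ∀ x y z, ψ (A ((x, y), z)) = B ((x + k, y + f x), z + g x y) := by
  obtain ⟨A₁, B₁, ψ₁, g₁, h₁, he₁⟩ := h.exists_quotient e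
  obtain ⟨A₂, B₂, ψ₂, g₂, h₂, he₂⟩ := h₁.exists_quotient (LinearEquiv.refl _ _)
  obtain ⟨_, _, _, z, z', hz, hz', _, hψ⟩ := h₂.exists_central
  have he₃ : ∀ x : ZMod p, ψ₂ (x • z) = x • z' + ψ₂ 0 := by
    intro x
    rw [← zero_add (x • z), map_add_smul_of_map_add hψ, add_comm]
  let L : ∀ (c : ZMod p), c ≠ 0 → ((ZMod p × ZMod p) ≃ₗ[ZMod p] (ZMod p × ZMod p)) →
      (((ZMod p × ZMod p) × ZMod p) ≃ₗ[ZMod p] V) →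
      (((ZMod p × ZMod p) × ZMod p) ≃ₗ[ZMod p] V) := fun c hc E₂ E₁ =>
    (LinearEquiv.prodCongr
      ((LinearEquiv.prodCongr (LinearEquiv.smulOfNeZero (ZMod p) (ZMod p) c hc)
        (LinearEquiv.refl _ _)).trans E₂) (LinearEquiv.refl _ _)).trans E₁
  have hL : ∀ c hc E₂ E₁ x y w, L c hc E₂ E₁ ((x, y), w) = E₁ (E₂ (x • c, y), w) := by
    intro c hc E₂ E₁ x y w
    simp [L, mul_comm]
  refine ⟨L z hz A₂ A₁, L z' hz' B₂ B₁, ψ₂ 0 / z', fun x => g₂ (x • z),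
    fun x y => g₁ (A₂ (x • z, y)), fun x y w => ?_⟩
  have hk : (ψ₂ 0 / z') • z' = ψ₂ 0 := div_mul_cancel₀ _ hz'
  rw [hL, hL, he₁, he₂, he₃, add_smul, hk]

end Flags

section Sylow

open Pointwise in
/-- Inside a finite group containing all `i u` and all `φ⁻¹ * i u * φ`, one can
modify `φ` so that these elements lie in a common `r`-subgroup. -/
theorem exists_conj_mem_pGroup {Γ U : Type*} [Group Γ] [Finite Γ] [Group U] {r : ℕ}
    [Fact r.Prime] (hU : IsPGroup r U) (i : U →* Γ) {N : Subgroup Γ} {φ : Γ}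
    (h₁ : ∀ u, i u ∈ N) (h₂ : ∀ u, φ⁻¹ * i u * φ ∈ N) :
    ∃ σ ∈ N, ∃ P ≤ N, IsPGroup r P ∧
      ∀ u, i u ∈ P ∧ (φ * σ)⁻¹ * i u * (φ * σ) ∈ P := by
  let j₁ : U →* N := i.codRestrict N h₁
  let j₂ : U →* N := ((MulAut.conj φ⁻¹).toMonoidHom.comp i).codRestrict N
    fun u => by simpa using h₂ u
  have hp (j : U →* N) : IsPGroup r j.range := hU.of_surjective _ j.rangeRestrict_surjective
  obtain ⟨Q₁, hQ₁⟩ := (hp j₁).exists_le_sylow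
  obtain ⟨Q₂, hQ₂⟩ := (hp j₂).exists_le_sylow
  obtain ⟨s, hs⟩ := MulAction.exists_smul_eq N Q₂ Q₁
  refine ⟨(s⁻¹ : N), (s⁻¹).2, (Q₁ : Subgroup N).map N.subtype, Subgroup.map_subtype_le _,
    Q₁.isPGroup'.map _, fun u => ⟨⟨j₁ u, hQ₁ ⟨u, rfl⟩, rfl⟩, ?_⟩⟩
  have hm : MulAut.conj s • j₂ u ∈ (MulAut.conj s • (Q₂ : Subgroup N) : Subgroup N) :=
    Subgroup.smul_mem_pointwise_smul _ _ _ (hQ₂ ⟨u, rfl⟩)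
  have hs' : (MulAut.conj s • (Q₂ : Subgroup N)) = Q₁ := by
    rw [← hs]; rfl
  rw [hs'] at hm
  refine ⟨_, hm, ?_⟩
  simp [j₂, mul_assoc]

theorem IsPGroup.smul_eq_of_card_orbit_lt {r : ℕ} [Fact r.Prime] {P α : Type*} [Group P]
    [MulAction P α] [Finite α] (hP : IsPGroup r P) {a : α}
    (h : Nat.card (MulAction.orbit P a) < r) (σ : P) : σ • a = a := by
  obtain ⟨n, hn⟩ := hP.card_orbit a
  have hr := (Fact.out : r.Prime).one_lt
  have : n = 0 := by
    by_contra h0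
    rw [hn] at h
    exact absurd (Nat.le_self_pow h0 r) (not_le.mpr h)
  rw [this, pow_zero, Nat.card_eq_one_iff_unique] at hn
  have := hn.1
  exact congrArg Subtype.val (Subsingleton.elim
    (⟨σ • a, MulAction.mem_orbit a σ⟩ : MulAction.orbit P a) ⟨a, MulAction.mem_orbit_self a⟩)

end Sylow

section Fibres

variable {q : ℕ} [Fact q.Prime] {V : Type*}

/-- `φ` maps every fibre of the projection to `V` affinely onto a fibre. -/
def IsFibreAffine (φ : Equiv.Perm (V × ZMod q)) : Prop :=
  ∀ v, ∃ w b c, c ≠ 0 ∧ ∀ x, φ (v, x) = (w, b + c * x)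

theorem IsFibreAffine.mul {φ σ : Equiv.Perm (V × ZMod q)} (hφ : IsFibreAffine φ)
    (hσ : IsFibreAffine σ) : IsFibreAffine (φ * σ) := by
  intro v
  obtain ⟨w, b, c, hc, h⟩ := hσ v
  obtain ⟨w', b', c', hc', h'⟩ := hφ w
  refine ⟨w', b' + c' * b, c' * c, mul_ne_zero hc' hc, fun x => ?_⟩
  rw [Equiv.Perm.mul_apply, h, h', mul_add, add_assoc, mul_assoc]

theorem IsFibreAffine.inv {φ : Equiv.Perm (V × ZMod q)} (hφ : IsFibreAffine φ) :
    IsFibreAffine φ⁻¹ := by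
  intro w
  obtain ⟨w', b, c, hc, h⟩ := hφ (φ⁻¹ (w, 0)).1
  have h0 := h (φ⁻¹ (w, 0)).2
  rw [Prod.mk.eta, show φ (φ⁻¹ (w, 0)) = (w, 0) from φ.apply_symm_apply _, Prod.mk.injEq] at h0
  refine ⟨(φ⁻¹ (w, 0)).1, (φ⁻¹ (w, 0)).2, c⁻¹, inv_ne_zero hc, fun y => ?_⟩
  rw [Equiv.Perm.inv_eq_iff_eq, h, mul_add, ← add_assoc, ← h0.2, zero_add,
    mul_inv_cancel_left₀ hc, h0.1]

theorem isFibreAffine_addRight [AddCommGroup V] (u : V × ZMod q) :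
    IsFibreAffine (Equiv.addRight u) := by
  refine fun v => ⟨v + u.1, u.2, 1, one_ne_zero, fun x => ?_⟩
  ext <;> simp [add_comm]

theorem IsFibreAffine.exists_perm [Finite V] {φ : Equiv.Perm (V × ZMod q)}
    (hφ : IsFibreAffine φ) :
    ∃ (ψ : Equiv.Perm V) (b : V → ZMod q) (c : V → (ZMod q)ˣ),
      ∀ v x, φ (v, x) = (ψ v, b v + c v * x) := by
  choose ψ b c hc h using hφ
  have hinj : Function.Injective ψ := by
    intro v w hvw
    have := h v ((c v)⁻¹ * (b w - b v))
    rw [mul_inv_cancel_left₀ (hc v), add_sub_cancel, hvw] at this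
    have h0 := h w 0
    rw [mul_zero, add_zero, ← this] at h0
    exact (congrArg Prod.fst (φ.injective h0)).symm
  exact ⟨Equiv.ofBijective ψ (Finite.injective_iff_bijective.mp hinj), b,
    fun v => Units.mk0 (c v) (hc v), fun v x => h v x⟩

/-- `φ` is an isomorphism from the Cayley digraph of `S` to that of `T`. -/
def IsCayleyIso {G : Type*} [AddGroup G] (S T : Set G) (φ : Equiv.Perm G) : Prop :=
  ∀ g h, g - h ∈ S ↔ φ g - φ h ∈ T

theorem isCayleyIso_addRight {G : Type*} [AddGroup G] (S : Set G) (u : G) :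
    IsCayleyIso S S (Equiv.addRight u) := fun g h => by simp

theorem IsCayleyIso.mul {G : Type*} [AddGroup G] {S T R : Set G} {φ σ : Equiv.Perm G}
    (hφ : IsCayleyIso T R φ) (hσ : IsCayleyIso S T σ) : IsCayleyIso S R (φ * σ) :=
  fun g h => (hσ g h).trans (hφ _ _)

theorem IsCayleyIso.inv {G : Type*} [AddGroup G] {S T : Set G} {φ : Equiv.Perm G}
    (hφ : IsCayleyIso S T φ) : IsCayleyIso T S φ⁻¹ := fun g h => by
  rw [hφ, show φ (φ⁻¹ g) = g from φ.apply_symm_apply _,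
    show φ (φ⁻¹ h) = h from φ.apply_symm_apply _]

/-- The automorphism group of the Cayley digraph of `S`. -/
def cayleyAut {G : Type*} [AddGroup G] (S : Set G) : Subgroup (Equiv.Perm G) where
  carrier := {σ | IsCayleyIso S S σ}
  mul_mem' := IsCayleyIso.mul
  one_mem' := fun _ _ => Iff.rfl
  inv_mem' := IsCayleyIso.inv

/-- The group of fibrewise affine permutations. -/
def fibreAffine (q : ℕ) [Fact q.Prime] (V : Type*) :
    Subgroup (Equiv.Perm (V × ZMod q)) where
  carrier := {σ | IsFibreAffine σ}
  mul_mem' := IsFibreAffine.mul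
  one_mem' := fun v => ⟨v, 0, 1, one_ne_zero, fun x => by simp⟩
  inv_mem' := IsFibreAffine.inv

/-- The translations by the elements in the image of `i`. -/
def translations {U G : Type*} [AddCommGroup U] [AddCommGroup G] (i : U →+ G) :
    Multiplicative U →* Equiv.Perm G where
  toFun u := Equiv.addRight (i u.toAdd)
  map_one' := by ext; simp
  map_mul' u v := by
    ext g
    simp [add_comm, add_left_comm]

variable [AddCommGroup V]

open Pointwise in
theorem exists_section {p : ℕ} [Fact p.Prime] (hpq : p ≠ q)
    {P : Subgroup (Equiv.Perm (V × ZMod q))} (hP : IsPGroup p P) (hA : P ≤ fibreAffine q V)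
    (ht : ∀ u, Equiv.addRight (u, (0 : ZMod q)) ∈ P) :
    ∃ x₀, ∀ σ ∈ P, ∀ v, (σ (v, x₀)).2 = x₀ := by
  let s : Set (V × ZMod q) := Set.range fun x => (0, x)
  have hs : ∀ σ : P, (σ.1 (0, 0)).1 = 0 → σ ∈ MulAction.stabilizer P s := by
    intro σ h0
    rw [MulAction.mem_stabilizer_set_iff_smul_set_subset s.toFinite]
    rintro _ ⟨_, ⟨x, rfl⟩, rfl⟩
    obtain ⟨w, b, c, -, h⟩ := hA σ.2 0
    rw [h 0] at h0
    refine ⟨b + c * x, ?_⟩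
    change _ = σ.1 (0, x)
    rw [h, ← h0]
  have hcard : ¬ p ∣ Nat.card s := by
    change ¬ p ∣ Nat.card (Set.range fun x : ZMod q => ((0 : V), x))
    rw [Nat.card_coe_set_eq, ← Set.image_univ,
      Set.ncard_image_of_injective _ (Prod.mk_right_injective 0), Set.ncard_univ, Nat.card_zmod]
    exact fun h => hpq ((Nat.prime_dvd_prime_iff_eq Fact.out Fact.out).mp h)
  obtain ⟨⟨_, x₀, rfl⟩, hx₀⟩ :=
    (hP.to_subgroup (MulAction.stabilizer P s)).nonempty_fixed_point_of_prime_not_dvd_card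
      s hcard
  refine ⟨x₀, fun σ hσ v => ?_⟩
  obtain ⟨w, b, c, -, h⟩ := hA hσ v
  let τ : P := ⟨_, ht (-w)⟩ * ⟨σ, hσ⟩ * ⟨_, ht v⟩
  have hτ : ∀ x, τ.1 (0, x) = (0, b + c * x) := by
    intro x
    change σ ((0, x) + (v, 0)) + (-w, 0) = _
    simp [h]
  have := congrArg Subtype.val (hx₀ ⟨τ, hs τ (by rw [hτ])⟩)
  have h1 : τ.1 (0, x₀) = (0, x₀) := this
  rw [hτ] at h1
  rw [h]
  exact congrArg Prod.snd h1

variable [Finite V]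

theorem exists_fibre_shift (hV : Nat.card V < q) {Q : Subgroup (Equiv.Perm (V × ZMod q))}
    (hQ : IsPGroup q Q) (ht : ∀ y, Equiv.addRight ((0 : V), y) ∈ Q)
    {σ : Equiv.Perm (V × ZMod q)} (hσ : σ ∈ Q) (v : V) :
    ∃ a, ∀ x, σ (v, x) = (v, x + a) := by
  have hq := (Fact.out : q.Prime)
  have hblock : ∀ v : V, (Set.range fun y : ZMod q => (v, y)).ncard = q := by
    intro v
    rw [← Set.image_univ, Set.ncard_image_of_injective _ (Prod.mk_right_injective v),
      Set.ncard_univ, Nat.card_zmod]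
  have horb : ∀ (v : V) (x : ZMod q),
      MulAction.orbit Q (v, x) = Set.range fun y : ZMod q => (v, y) := by
    intro v x
    have hsub : (Set.range fun y : ZMod q => (v, y)) ⊆ MulAction.orbit Q (v, x) := by
      rintro _ ⟨y, rfl⟩
      refine ⟨⟨_, ht (y - x)⟩, ?_⟩
      change (v, x) + (0, y - x) = (v, y)
      simp
    refine (Set.eq_of_subset_of_ncard_le hsub ?_).symm
    rw [hblock]
    obtain ⟨n, hn⟩ := hQ.card_orbit (v, x)
    rw [Nat.card_coe_set_eq] at hn
    rw [hn]
    have hlt : q ^ n < q ^ 2 := by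
      calc q ^ n ≤ Nat.card (V × ZMod q) := by
            rw [← hn]; exact Set.ncard_le_card _
        _ = Nat.card V * q := by rw [Nat.card_prod, Nat.card_zmod]
        _ < q ^ 2 := by
            rw [sq]; exact Nat.mul_lt_mul_of_pos_right hV hq.pos
    have := (Nat.pow_lt_pow_iff_right hq.one_lt).mp hlt
    calc q ^ n ≤ q ^ 1 := Nat.pow_le_pow_right hq.pos (by omega)
      _ = q := pow_one q
  have hfst : ∀ τ ∈ Q, ∀ v x, τ (v, x) = (v, (τ (v, x)).2) := by
    intro τ hτ v x
    have : τ (v, x) ∈ MulAction.orbit Q (v, x) := ⟨⟨τ, hτ⟩, rfl⟩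
    rw [horb] at this
    obtain ⟨y, hy⟩ := this
    rw [← hy]
  have hfix : ∀ τ ∈ Q, τ (v, 0) = (v, 0) → ∀ x, τ (v, x) = (v, x) := by
    intro τ hτ hτ0 x
    by_cases hx : x = 0
    · rw [hx, hτ0]
    let R := MulAction.stabilizer Q ((v, 0) : V × ZMod q)
    have hR : IsPGroup q R := hQ.to_subgroup R
    refine hR.smul_eq_of_card_orbit_lt (a := (v, x)) ?_ ⟨⟨τ, hτ⟩, hτ0⟩
    rw [Nat.card_coe_set_eq]
    refine lt_of_lt_of_eq ?_ (hblock v)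
    refine Set.ncard_lt_ncard ⟨?_, fun h => ?_⟩
    · rintro _ ⟨ρ, rfl⟩
      exact ⟨_, (hfst _ ρ.1.2 v x).symm⟩
    · obtain ⟨ρ, hρ⟩ := h ⟨0, rfl⟩
      have h0 : ρ.1.1 (v, 0) = (v, 0) := ρ.2
      have h1 : ρ.1.1 (v, x) = (v, 0) := hρ
      rw [← h0] at h1
      exact hx (congrArg Prod.snd (ρ.1.1.injective h1))
  refine ⟨(σ (v, 0)).2, fun x => ?_⟩
  have := hfix _ (Q.mul_mem (ht (-(σ (v, 0)).2)) hσ) (by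
    rw [Equiv.Perm.mul_apply, hfst σ hσ v 0]; simp) x
  rw [Equiv.Perm.mul_apply, Equiv.coe_addRight, ← eq_sub_iff_add_eq] at this
  rw [this]
  simp

theorem IsCayleyIso.exists_isFibreAffine (hV : Nat.card V < q) {S T : Set (V × ZMod q)}
    {φ : Equiv.Perm (V × ZMod q)} (hφ : IsCayleyIso S T φ) :
    ∃ φ', IsCayleyIso S T φ' ∧ IsFibreAffine φ' := by
  have hq : IsPGroup q (Multiplicative (ZMod q)) := IsPGroup.of_card (n := 1) (by simp)
  obtain ⟨σ, hσ, Q, -, hQ, hu⟩ := exists_conj_mem_pGroup hq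
    (translations (AddMonoidHom.inr V (ZMod q))) (N := cayleyAut S) (φ := φ)
    (fun u => isCayleyIso_addRight _ _)
    (fun u => (hφ.inv.mul (isCayleyIso_addRight _ _)).mul hφ)
  refine ⟨φ * σ, hφ.mul hσ, fun v => ?_⟩
  set θ := φ * σ
  obtain ⟨a, ha⟩ := exists_fibre_shift hV hQ (fun y => (hu (Multiplicative.ofAdd y)).1)
    (hu (Multiplicative.ofAdd 1)).2 v
  have ha' : ∀ x, θ (v, x + a) = θ (v, x) + (0, 1) := by
    intro x
    rw [← ha x]
    exact θ.apply_symm_apply _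
  have ha0 : a ≠ 0 := by
    intro h0
    have := ha' 0
    simp [h0] at this
  refine ⟨(θ (v, 0)).1, (θ (v, 0)).2, 1 / a, one_div_ne_zero ha0, fun x => Prod.ext ?_ ?_⟩
  · exact eq_of_period (X := fun x => (θ (v, x)).1) ha0 (fun z => by simp [ha']) x 0
  · exact eq_linear_of_step (f := fun x => (θ (v, x)).2) ha0 (fun z => by simp [ha']) x

/-- An isomorphic pair of Cayley digraphs on `V × ZMod q` is isomorphic through a map which is
linear on fibres and induces on `V` a permutation compatible with a `p`-group. -/
theorem IsCayleyIso.exists_normal_form {p n : ℕ} [Fact p.Prime] (hpV : Nat.card V = p ^ n)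
    (hpq : p ≠ q) (hV : Nat.card V < q) {S T : Set (V × ZMod q)}
    {φ : Equiv.Perm (V × ZMod q)} (hφ : IsCayleyIso S T φ) :
    ∃ (ψ : Equiv.Perm V) (c : V → (ZMod q)ˣ), JoinsInPGroup p ψ ∧
      ∀ v w x y, (v - w, x - y) ∈ S ↔ (ψ v - ψ w, (c v : ZMod q) * x - c w * y) ∈ T := by
  obtain ⟨φ₁, hφ₁, ha₁⟩ := hφ.exists_isFibreAffine hV
  have hp : IsPGroup p (Multiplicative V) := IsPGroup.of_card (n := n)
    ((Nat.card_congr Multiplicative.toAdd).trans hpV)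
  obtain ⟨σ, hσ, P, hPN, hP, hu⟩ := exists_conj_mem_pGroup hp
    (translations (AddMonoidHom.inl V (ZMod q))) (N := cayleyAut S ⊓ fibreAffine q V) (φ := φ₁)
    (fun u => ⟨isCayleyIso_addRight _ _, isFibreAffine_addRight _⟩)
    (fun u => ⟨(hφ₁.inv.mul (isCayleyIso_addRight _ _)).mul hφ₁,
      (ha₁.inv.mul (isFibreAffine_addRight _)).mul ha₁⟩)
  have hθ := hφ₁.mul hσ.1
  have hθa := ha₁.mul hσ.2
  set θ := φ₁ * σ
  have ht : ∀ u, Equiv.addRight (u, (0 : ZMod q)) ∈ P :=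
    fun u => (hu (Multiplicative.ofAdd u)).1
  have ht' : ∀ u, θ⁻¹ * Equiv.addRight (u, (0 : ZMod q)) * θ ∈ P :=
    fun u => (hu (Multiplicative.ofAdd u)).2
  obtain ⟨x₀, hx₀⟩ := exists_section hpq hP (hPN.trans inf_le_right) ht
  obtain ⟨ψ, b, c, hψ⟩ := hθa.exists_perm
  have key : ∀ u v, ∃ v', (θ⁻¹ * Equiv.addRight (u, (0 : ZMod q)) * θ) (v, x₀) = (v', x₀) ∧
      ψ v' = ψ v + u ∧ b v' + c v' * x₀ = b v + c v * x₀ := by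
    intro u v
    refine ⟨_, Prod.ext rfl (hx₀ _ (ht' u) v), ?_⟩
    set v' := ((θ⁻¹ * Equiv.addRight (u, (0 : ZMod q)) * θ) (v, x₀)).1 with hv'
    have h1 : θ (v', x₀) = θ (v, x₀) + (u, 0) := by
      have : (v', x₀) = (θ⁻¹ * Equiv.addRight (u, (0 : ZMod q)) * θ) (v, x₀) :=
        Prod.ext rfl (hx₀ _ (ht' u) v).symm
      rw [this]
      exact θ.apply_symm_apply _
    rw [hψ, hψ, Prod.mk_add_mk, add_zero, Prod.mk.injEq] at h1
    exact h1
  have hconst : ∀ v w, b v + c v * x₀ = b w + c w * x₀ := by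
    intro v w
    obtain ⟨v', -, h1, h2⟩ := key (ψ v - ψ w) w
    rw [add_sub_cancel] at h1
    rwa [ψ.injective h1] at h2
  refine ⟨ψ, c, ?_, fun v w x y => ?_⟩
  · let act : MulAction P V :=
      { smul := fun g v => (g.1 (v, x₀)).1
        one_smul := fun v => rfl
        mul_smul := by
          intro g g' v
          change (g.1 (g'.1 (v, x₀))).1 = (g.1 ((g'.1 (v, x₀)).1, x₀)).1
          rw [show ((g'.1 (v, x₀)).1, x₀) = g'.1 (v, x₀) from
            Prod.ext rfl (hx₀ g'.1 g'.2 v).symm] }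
    refine JoinsInPGroup.of_action hP (fun u => ⟨⟨_, ht u⟩, fun v => rfl⟩)
      (fun u => ⟨⟨_, ht' u⟩, fun v => ?_⟩)
    obtain ⟨v', h1, h2, -⟩ := key u v
    change ψ ((θ⁻¹ * Equiv.addRight (u, (0 : ZMod q)) * θ) (v, x₀)).1 = _
    rw [h1, h2]
  · have := hθ (v, x + x₀) (w, y + x₀)
    rw [hψ, hψ, Prod.mk_sub_mk, Prod.mk_sub_mk, add_sub_add_right_eq_sub] at this
    rw [this]
    have h3 : b v + c v * (x + x₀) - (b w + c w * (y + x₀)) = c v * x - c w * y := by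
      linear_combination hconst v w
    rw [h3]

end Fibres

section Assembly

open Pointwise

variable {p q : ℕ} [Fact p.Prime] [Fact q.Prime]

theorem smul_slice_eq_or_eq {V : Type*} [AddCommGroup V] {S T : Set (V × ZMod q)} {ψ : V → V}
    {c : V → (ZMod q)ˣ}
    (h : ∀ v w x y, (v - w, x - y) ∈ S ↔ (ψ v - ψ w, (c v : ZMod q) * x - c w * y) ∈ T) (d : V) :
    (∀ u : (ZMod q)ˣ, u • {x | (d, x) ∈ S} = {x | (d, x) ∈ S}) ∨ ∀ v, c (v + d) = c v := by
  by_cases hc : ∀ v, c (v + d) = c v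
  · exact .inr hc
  push Not at hc
  obtain ⟨v, hv⟩ := hc
  have hc0 : (c (v + d) : ZMod q) ≠ 0 := (c (v + d)).ne_zero
  have hv' : (c (v + d) : ZMod q) - c v ≠ 0 := sub_ne_zero.mpr fun h => hv (Units.ext h)
  have hconst : ∀ s t, (d, s) ∈ S ↔ (d, t) ∈ S := by
    intro s t
    set y : ZMod q := (t - s) * c (v + d) / (c (v + d) - c v) with hy
    have h1 := h (v + d) v (s + y) y
    have h2 := h (v + d) v t 0
    rw [add_sub_cancel_left, add_sub_cancel_right] at h1
    rw [add_sub_cancel_left, sub_zero] at h2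
    rw [h1, h2]
    have : (c (v + d) : ZMod q) * (s + y) - c v * y = c (v + d) * t - c v * 0 := by
      rw [hy]; field_simp; ring
    rw [this]
  refine .inl fun u => Set.ext fun x => ?_
  rw [Set.mem_smul_set_iff_inv_smul_mem]
  exact hconst _ _

/-- The unitriangular additive automorphism with the given coefficients. -/
def unitriangularAddEquiv {R : Type*} [Ring R] (l m n : R) : ((R × R) × R) ≃+ ((R × R) × R) where
  toFun d := ((d.1.1, d.1.2 + l * d.1.1), d.2 + m * d.1.1 + n * d.1.2)
  invFun d := ((d.1.1, d.1.2 - l * d.1.1), d.2 - m * d.1.1 - n * (d.1.2 - l * d.1.1))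
  left_inv d := by ext <;> simp; abel
  right_inv d := by ext <;> simp; abel
  map_add' d d' := by
    ext
    · rfl
    · simp only [Prod.fst_add, Prod.snd_add, mul_add]; abel
    · simp only [Prod.fst_add, Prod.snd_add, mul_add]; abel

theorem exists_addEquiv_of_normal_form {V : Type*} [AddCommGroup V] [Module (ZMod p) V]
    (e : ((ZMod p × ZMod p) × ZMod p) ≃ₗ[ZMod p] V) {S T : Set (V × ZMod q)}
    {ψ : Equiv.Perm V} {c : V → (ZMod q)ˣ} (hψ : JoinsInPGroup p ψ)
    (h : ∀ v w x y, (v - w, x - y) ∈ S ↔ (ψ v - ψ w, (c v : ZMod q) * x - c w * y) ∈ T) :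
    ∃ μ : (V × ZMod q) ≃+ (V × ZMod q), μ '' S = T := by
  obtain ⟨A, B, k₀, f, g, hAB⟩ := hψ.exists_triangular e
  let s : V → Set (ZMod q) := fun d => {x | (d, x) ∈ S}
  let t : V → Set (ZMod q) := fun d => {x | (d, x) ∈ T}
  have hst : ∀ v d, t (ψ (v + d) - ψ v) = c (v + d) • s d := by
    intro v d
    ext x
    rw [Set.mem_smul_set_iff_inv_smul_mem]
    have := h (v + d) v ((c (v + d))⁻¹ • x) 0
    rw [add_sub_cancel_left, sub_zero, mul_zero, sub_zero, ← smul_eq_mul, ← Units.smul_def,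
      smul_inv_smul] at this
    exact this.symm
  have hE : ∀ x y w a b z, t (B ((a, b + (f (x + a) - f x)), z + (g (x + a) (y + b) - g x y))) =
      c (A ((x + a, y + b), w + z)) • s (A ((a, b), z)) := by
    intro x y w a b z
    have := hst (A ((x, y), w)) (A ((a, b), z))
    rw [← map_add, Prod.mk_add_mk, Prod.mk_add_mk, hAB, hAB, ← map_sub] at this
    rw [← this]
    congr 2
    ext
    · simp
    · simp only [Prod.fst_sub, Prod.snd_sub]; ring
    · simp only [Prod.snd_sub]; ring
  have hc₀ : ∀ x y w d, c (A ((x, y), w)) • s (A d) = c (A ((x, y), 0)) • s (A d) := by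
    rintro x y w ⟨⟨a, b⟩, z⟩
    have h1 := hE (x - a) (y - b) (w - z) a b z
    have h2 := hE (x - a) (y - b) (-z) a b z
    rw [h1] at h2
    simpa using h2
  have hfix := fun d => smul_slice_eq_or_eq h (A d)
  set r := c (A ((0, 0), 0))
  have hkr : ∀ x y (X : Set (ZMod q)), (c (A ((x, y), 0)) * r⁻¹) • r • X =
      c (A ((x, y), 0)) • X := fun x y X => by rw [smul_smul, inv_mul_cancel_right]
  obtain ⟨l, m, n, hlmn⟩ := unitriangularEquiv_of_twist
    (S := fun a b z => r • s (A ((a, b), z))) (T := fun a b z => t (B ((a, b), z)))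
    (f := f) (g := g) (k := fun x y => c (A ((x, y), 0)) * r⁻¹) (mul_inv_cancel r)
    (by
      intro x y a b z
      rw [hkr, hE x y 0 a b z]
      rcases hfix ((a, b), z) with h1 | h1
      · rw [h1, h1]
      · have := h1 (A ((x, y), 0))
        rw [← map_add] at this
        exact congrArg (· • s (A ((a, b), z))) this)
    (by
      intro a b
      by_cases hz : ∃ z, ∀ v, c (v + A ((a, b), z)) = c v
      · obtain ⟨z, hz⟩ := hz
        refine .inr fun x y a' b' z' => ?_
        rw [hkr, hkr, ← hc₀ (x + a) (y + b) (0 + z)]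
        have := hz (A ((x, y), 0))
        rw [← map_add] at this
        exact congrArg (· • s (A ((a', b'), z'))) this
      · refine .inl fun z u => ?_
        have := (hfix ((a, b), z)).resolve_right fun h1 => hz ⟨z, h1⟩
        change u • r • s _ = r • s _
        rw [this, this])
  let μ : (V × ZMod q) ≃+ (V × ZMod q) := AddEquiv.prodCongr
    ((A.symm.toAddEquiv.trans (unitriangularAddEquiv l m n)).trans B.toAddEquiv)
    (DistribMulAction.toAddEquiv _ r)
  have hμ : ∀ w, μ w ∈ T ↔ w ∈ S := by
    rintro ⟨v, x⟩
    obtain ⟨⟨⟨a, b⟩, z⟩, rfl⟩ := A.surjective v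
    have h1 : μ (A ((a, b), z), x) = (B ((a, b + l * a), z + m * a + n * b), r • x) := by
      refine Prod.ext ?_ rfl
      change B (unitriangularAddEquiv l m n (A.symm (A ((a, b), z)))) = _
      rw [LinearEquiv.symm_apply_apply]
      rfl
    have h2 : r • x ∈ t (B ((a, b + l * a), z + m * a + n * b)) ↔ x ∈ s (A ((a, b), z)) := by
      rw [show t _ = r • s _ from hlmn a b z]
      exact Set.smul_mem_smul_set_iff
    rw [h1]
    exact h2
  refine ⟨μ, Set.ext fun w => ?_⟩
  obtain ⟨w, rfl⟩ := μ.surjective w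
  rw [μ.injective.mem_set_image, hμ]

end Assembly

/-- For primes `p > 3` and `q > p³`, the group `G = (ℤ/pℤ)³ × ℤ/qℤ` is a DCI-group:
for all subsets `S, T ⊆ G`, if some bijection `φ : G → G` satisfies
`g - h ∈ S ↔ φ g - φ h ∈ T` for all `g, h` (a digraph isomorphism `Cay(G,S) ≅ Cay(G,T)`),
then some group automorphism `μ` of `G` satisfies `μ '' S = T`. -/
theorem dci_zmod_p3_q (p q : ℕ) (hp : p.Prime) (hq : q.Prime)
    (hp3 : 3 < p) (hq3 : p ^ 3 < q)
    (S T : Set ((Fin 3 → ZMod p) × ZMod q))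
    (φ : ((Fin 3 → ZMod p) × ZMod q) ≃ ((Fin 3 → ZMod p) × ZMod q))
    (hφ : ∀ g h : (Fin 3 → ZMod p) × ZMod q, g - h ∈ S ↔ φ g - φ h ∈ T) :
    ∃ μ : ((Fin 3 → ZMod p) × ZMod q) ≃+ ((Fin 3 → ZMod p) × ZMod q),
      (μ : ((Fin 3 → ZMod p) × ZMod q) → ((Fin 3 → ZMod p) × ZMod q)) '' S = T := by
  have : Fact p.Prime := ⟨hp⟩
  have : Fact q.Prime := ⟨hq⟩
  have hV : Nat.card (Fin 3 → ZMod p) = p ^ 3 := by simp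
  have hpq : p ≠ q := (lt_of_le_of_lt (Nat.le_self_pow three_ne_zero p) hq3).ne
  have hφ' : IsCayleyIso S T φ := hφ
  obtain ⟨ψ, c, hψ, h⟩ := hφ'.exists_normal_form hV hpq (hV ▸ hq3)
  exact exists_addEquiv_of_normal_form
    (LinearEquiv.ofFinrankEq ((ZMod p × ZMod p) × ZMod p) (Fin 3 → ZMod p) (by simp)) hψ h
end

section
/- Let G be a finite group, S ⊆ G, and let A ≤ Sym(G) be the group of automorphisms of the Cayley digraph Cay(G,S), i.e. bijections π : G → G with g·h⁻¹ ∈ S ↔ π(g)·π(h)⁻¹ ∈ S for all g, h. Let Ĝ ≤ A be the subgroup of right translations x ↦ x·g (g ∈ G). Then the following are equivalent: (i) Cay(G,S) is a CI-graph, i.e. for every T ⊆ G, if there is a bijection φ : G → G with g·h⁻¹ ∈ S ↔ φ(g)·φ(h)⁻¹ ∈ T for all g, h, then there is a group automorphism μ of G with μ(S) = T; (ii) for every subgroup H ≤ A that is isomorphic to G as an abstract group and acts regularly on G, there exists α ∈ A with α⁻¹Hα = Ĝ. -/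
/-- A regular permutation group on `G` isomorphic to `G` is carried to the right translations by
some bijection of `G`. -/
theorem exists_equiv_conj_mulRight {G : Type*} [Group G] {H : Subgroup (Equiv.Perm G)}
    (e : H ≃* G) (hreg : ∀ x y : G, ∃! h : H, (h : Equiv.Perm G) x = y) :
    ∃ θ : G ≃ G, ∀ (h : H) (x : G), (h : Equiv.Perm G) (θ x) = θ (x * (e h)⁻¹) := by
  have hbij : Function.Bijective fun x : G => (e.symm x⁻¹ : Equiv.Perm G) 1 := by
    constructor
    · intro x y hxy
      have h := (hreg 1 ((e.symm y⁻¹ : Equiv.Perm G) 1)).unique hxy rfl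
      simpa using h
    · intro y
      obtain ⟨h, hh, -⟩ := hreg 1 y
      exact ⟨(e h)⁻¹, by simpa using hh⟩
  refine ⟨Equiv.ofBijective _ hbij, fun h x => ?_⟩
  change (h : Equiv.Perm G) ((e.symm x⁻¹ : Equiv.Perm G) 1) =
    (e.symm (x * (e h)⁻¹)⁻¹ : Equiv.Perm G) 1
  rw [mul_inv_rev, inv_inv, map_mul, e.symm_apply_apply]
  rfl

/-- The conjugate by a bijection `φ` of the action of `G` on itself by
`x ↦ x * g⁻¹`. -/
def conjMulRightHom {G : Type*} [Group G] (φ : G ≃ G) : G →* Equiv.Perm G where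
  toFun g := (φ.trans (Equiv.mulRight g⁻¹)).trans φ.symm
  map_one' := by ext; simp
  map_mul' a b := by ext; simp [mul_assoc]

theorem conjMulRightHom_apply {G : Type*} [Group G] (φ : G ≃ G) (g x : G) :
    conjMulRightHom φ g x = φ.symm (φ x * g⁻¹) := rfl

theorem conjMulRightHom_injective {G : Type*} [Group G] (φ : G ≃ G) :
    Function.Injective (conjMulRightHom φ) := by
  intro a b hab
  simpa [conjMulRightHom_apply] using DFunLike.congr_fun hab 1

theorem existsUnique_conjMulRightHom_range {G : Type*} [Group G] (φ : G ≃ G) (x y : G) :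
    ∃! h : (conjMulRightHom φ).range, (h : Equiv.Perm G) x = y := by
  refine ⟨⟨_, (φ y)⁻¹ * φ x, rfl⟩, ?_, ?_⟩
  · change conjMulRightHom φ ((φ y)⁻¹ * φ x) x = y
    rw [conjMulRightHom_apply]
    simp
  · rintro ⟨_, g, rfl⟩ rfl
    simp [conjMulRightHom_apply]

/-- A bijection that normalizes the right translations is a group automorphism followed by a
right translation. -/
theorem exists_mulEquiv_of_normalizes_mulRight {G : Type*} [Group G] (ψ : G ≃ G)
    (hψ : ∀ k : G, ∃ g : G, ∀ x : G, ψ (x * k) = ψ x * g) :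
    ∃ μ : G ≃* G, ∀ x : G, μ x = ψ x * (ψ 1)⁻¹ := by
  refine ⟨{ ψ.trans (Equiv.mulRight (ψ 1)⁻¹) with map_mul' := fun x k => ?_ }, fun x => rfl⟩
  obtain ⟨g, hg⟩ := hψ k
  have hk := hg 1
  rw [one_mul] at hk
  simp [hg x, hk, mul_assoc]


/-- Babai's criterion: `Cay(G,S)` is a CI-graph if and only if every regular subgroup of
`A = Aut(Cay(G,S))` isomorphic to `G` is conjugate in `A` to the group `Ĝ` of right
translations. -/
theorem babai_criterion {G : Type*} [Group G] [Fintype G] (S : Set G)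
    (A : Subgroup (Equiv.Perm G))
    (hA : ∀ π : Equiv.Perm G, π ∈ A ↔ ∀ g h : G, g * h⁻¹ ∈ S ↔ π g * (π h)⁻¹ ∈ S)
    (Ghat : Subgroup (Equiv.Perm G))
    (hGhat : ∀ π : Equiv.Perm G, π ∈ Ghat ↔ ∃ g : G, ∀ x : G, π x = x * g) :
    ((∀ T : Set G,
        (∃ φ : G ≃ G, ∀ g h : G, g * h⁻¹ ∈ S ↔ φ g * (φ h)⁻¹ ∈ T) →
        ∃ μ : G ≃* G, (μ : G → G) '' S = T)
      ↔
      (∀ H : Subgroup (Equiv.Perm G), H ≤ A → Nonempty (H ≃* G) →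
        (∀ x y : G, ∃! h : H, (h : Equiv.Perm G) x = y) →
        ∃ α ∈ A, (fun π : Equiv.Perm G => α⁻¹ * π * α) '' (H : Set (Equiv.Perm G))
          = (Ghat : Set (Equiv.Perm G)))) := by
  constructor
  · rintro hCI H hHA ⟨e⟩ hreg
    obtain ⟨θ, hθ⟩ := exists_equiv_conj_mulRight e hreg
    have hsurj : ∀ k : G, ∃ h : H, ∀ x, (h : Equiv.Perm G) (θ x) = θ (x * k) := fun k =>
      ⟨e.symm k⁻¹, fun x => by rw [hθ]; simp⟩
    have hT : ∀ g h : G, g * h⁻¹ ∈ {z | θ z * (θ 1)⁻¹ ∈ S} ↔ θ g * (θ h)⁻¹ ∈ S := by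
      intro g h
      obtain ⟨π, hπ⟩ := hsurj h⁻¹
      rw [(hA π).1 (hHA π.2) (θ g) (θ h), hπ, hπ, mul_inv_cancel, Set.mem_ofPred_eq]
    obtain ⟨μ, hμ⟩ := hCI {z | θ z * (θ 1)⁻¹ ∈ S}
      ⟨θ.symm, fun g h => by rw [hT]; simp⟩
    refine ⟨μ.toEquiv.trans θ, (hA _).2 fun g h => ?_, ?_⟩
    · change _ ↔ θ (μ g) * (θ (μ h))⁻¹ ∈ S
      rw [← hT, ← hμ, ← map_inv, ← map_mul, μ.injective.mem_set_image]
    · ext π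
      rw [SetLike.mem_coe, hGhat]
      constructor
      · rintro ⟨h, hh, rfl⟩
        refine ⟨μ.symm (e ⟨h, hh⟩)⁻¹, fun x => ?_⟩
        change μ.symm (θ.symm (h (θ (μ x)))) = _
        rw [hθ ⟨h, hh⟩]
        simp
      · rintro ⟨k, hk⟩
        obtain ⟨h, hh⟩ := hsurj (μ k)
        refine ⟨h, h.2, Equiv.ext fun x => ?_⟩
        change μ.symm (θ.symm ((h : Equiv.Perm G) (θ (μ x)))) = _
        rw [hh, hk]
        simp
  · rintro hconj T ⟨φ, hφ⟩
    obtain ⟨α, hα, himage⟩ := hconj (conjMulRightHom φ).range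
      (by
        rintro _ ⟨k, rfl⟩
        refine (hA _).2 fun g h => ?_
        rw [hφ g h, hφ, conjMulRightHom_apply, conjMulRightHom_apply]
        simp)
      ⟨(MonoidHom.ofInjective (conjMulRightHom_injective φ)).symm⟩
      (existsUnique_conjMulRightHom_range φ)
    have hnorm : ∀ k : G, ∃ g : G, ∀ x : G,
        (α.trans φ) (x * k) = (α.trans φ) x * g := by
      intro k
      have hk : Equiv.mulRight k ∈ (Ghat : Set (Equiv.Perm G)) := (hGhat _).2 ⟨k, fun _ => rfl⟩
      rw [← himage] at hk
      obtain ⟨_, ⟨g, rfl⟩, hg⟩ := hk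
      refine ⟨g⁻¹, fun x => ?_⟩
      have hx : α.symm (φ.symm (φ (α x) * g⁻¹)) = x * k := DFunLike.congr_fun hg x
      simp [← hx]
    obtain ⟨μ, hμ⟩ := exists_mulEquiv_of_normalizes_mulRight _ hnorm
    have hST : ∀ s, s ∈ S ↔ μ s ∈ T := fun s => by
      have h := ((hA α).1 hα s 1).trans (hφ _ _)
      rw [inv_one, mul_one] at h
      rw [hμ]
      exact h
    refine ⟨μ, Set.ext fun t => ?_⟩
    obtain ⟨s, rfl⟩ := μ.surjective t
    rw [μ.injective.mem_set_image, hST]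
end

section
/- Let p be a prime and let Γ be a digraph on the disjoint union V = A ⊔ B of two copies A, B of ℤ/pℤ. Suppose the permutation sending a ∈ A to a+1 and b ∈ B to b+1 is an automorphism of Γ, and suppose that for some r, s ∈ ℤ/pℤ the permutation sending a ∈ A to a+r and b ∈ B to b+s is also an automorphism of Γ. If A ≁ B, then r = s. -/
/-- `A ∼ B` for disjoint vertex subsets of a digraph with edge relation `E`. -/
def DigraphSim {V : Type*} (E : V → V → Prop) (A B : Set V) : Prop :=
  (∀ a ∈ A, ∀ b ∈ B, E a b ∧ ¬ E b a) ∨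
  (∀ a ∈ A, ∀ b ∈ B, E b a ∧ ¬ E a b) ∨
  (∀ a ∈ A, ∀ b ∈ B, E a b ∧ E b a) ∨
  (∀ a ∈ A, ∀ b ∈ B, ¬ E a b ∧ ¬ E b a)

/-- A binary relation on `ℤ/pℤ` invariant under the shifts by `(1, 1)` and by `(r, s)`,
with `r ≠ s`, is constant. -/
theorem iff_of_shift_invariant {p : ℕ} [Fact p.Prime] {R : ZMod p → ZMod p → Prop} {r s : ZMod p}
    (h1 : ∀ a b, R a b ↔ R (a + 1) (b + 1)) (hrs : ∀ a b, R a b ↔ R (a + r) (b + s))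
    (hne : r ≠ s) (a b a' b' : ZMod p) : R a b ↔ R a' b' := by
  have hnat : ∀ (n : ℕ) (a b : ZMod p), R a b ↔ R (a + n) (b + n) := by
    intro n
    induction n with
    | zero => simp
    | succ n ih =>
      intro a b
      rw [ih a b, h1]
      push_cast
      simp only [add_assoc]
  have hdiag : ∀ c a b : ZMod p, R a b ↔ R (a + c) (b + c) := by
    intro c a b
    simpa using hnat c.val a b
  have hstep : ∀ a b : ZMod p, R a b ↔ R a (b + (s - r)) := by
    intro a b
    rw [hrs a b, hdiag (-r)]
    simp only [add_neg_cancel, add_zero, sub_eq_add_neg, add_assoc]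
  have hiter : ∀ (n : ℕ) (a b : ZMod p), R a b ↔ R a (b + n * (s - r)) := by
    intro n
    induction n with
    | zero => simp
    | succ n ih =>
      intro a b
      rw [ih a b, hstep]
      push_cast
      simp only [add_mul, one_mul, add_assoc]
  have hd : s - r ≠ 0 := sub_ne_zero.mpr hne.symm
  have hright : ∀ a b b' : ZMod p, R a b ↔ R a b' := by
    intro a b b'
    simpa [div_mul_cancel₀ _ hd] using hiter ((b' - b) / (s - r)).val a b
  rw [hdiag (a' - a) a b, add_sub_cancel]
  exact hright _ _ _

/-- Lemma (paper, Lemma 4(b)): on the disjoint union `A ⊔ B` of two copies of `ℤ/pℤ`,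
if the simultaneous shift by `1` and the shift by `r` on `A`, `s` on `B` are both digraph
automorphisms and `A ≁ B`, then `r = s`. -/
theorem shift_eq_of_not_sim (p : ℕ) (hp : p.Prime)
    (E : (ZMod p ⊕ ZMod p) → (ZMod p ⊕ ZMod p) → Prop)
    (h1 : ∀ x y : ZMod p ⊕ ZMod p,
      E x y ↔ E (Sum.map (· + (1 : ZMod p)) (· + (1 : ZMod p)) x)
               (Sum.map (· + (1 : ZMod p)) (· + (1 : ZMod p)) y))
    (r s : ZMod p)
    (hrs : ∀ x y : ZMod p ⊕ ZMod p,
      E x y ↔ E (Sum.map (· + r) (· + s) x) (Sum.map (· + r) (· + s) y))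
    (hnsim : ¬ DigraphSim E (Set.range Sum.inl) (Set.range Sum.inr)) :
    r = s := by
  have : Fact p.Prime := ⟨hp⟩
  by_contra hne
  have hAB := iff_of_shift_invariant (R := fun a b => E (Sum.inl a) (Sum.inr b))
    (fun a b => h1 _ _) (fun a b => hrs _ _) hne
  have hBA := iff_of_shift_invariant (R := fun a b => E (Sum.inr b) (Sum.inl a))
    (fun a b => h1 _ _) (fun a b => hrs _ _) hne
  apply hnsim
  simp only [DigraphSim, Set.forall_mem_range]
  have hAB0 := fun a b => hAB a b 0 0
  have hBA0 := fun a b => hBA a b 0 0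
  simp only [hAB0, hBA0, forall_const]
  tauto
end

section
/- Let p be a prime, n a natural number, and Ω a finite set of cardinality pⁿ. Let H ≤ Sym(Ω) be an abelian subgroup acting regularly on Ω, and let P be a Sylow p-subgroup of Sym(Ω) with H ≤ P. Then the center Z(P) of P is contained in H. -/
/-- Lemma (paper, Lemma 5): if `H` is a regular abelian subgroup of `Sym(Ω)` with
`|Ω| = pⁿ` and `P` is a Sylow `p`-subgroup of `Sym(Ω)` containing `H`, then the center
of `P` is contained in `H`. -/
theorem center_sylow_le_regular_abelian (p n : ℕ) (hp : p.Prime)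
    {Ω : Type*} [Fintype Ω] [DecidableEq Ω] (hcard : Fintype.card Ω = p ^ n)
    (H : Subgroup (Equiv.Perm Ω))
    (habelian : ∀ a ∈ H, ∀ b ∈ H, a * b = b * a)
    (hregular : ∀ x y : Ω, ∃! h : H, (h : Equiv.Perm Ω) x = y)
    (P : Sylow p (Equiv.Perm Ω)) (hHP : H ≤ (P : Subgroup (Equiv.Perm Ω))) :
    ∀ z ∈ (P : Subgroup (Equiv.Perm Ω)),
      (∀ g ∈ (P : Subgroup (Equiv.Perm Ω)), z * g = g * z) → z ∈ H := by
  intro z _ hz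
  have : Nonempty Ω := Fintype.card_pos_iff.mp (hcard ▸ pow_pos hp.pos n)
  obtain ⟨x⟩ := this
  obtain ⟨h, hx, -⟩ := hregular x (z x)
  have hzh : z = h := by
    ext y
    obtain ⟨k, rfl, -⟩ := hregular x y
    calc z ((k : Equiv.Perm Ω) x) = (k : Equiv.Perm Ω) (z x) :=
          Equiv.congr_fun (hz k (hHP k.2)) x
      _ = (k : Equiv.Perm Ω) ((h : Equiv.Perm Ω) x) := by rw [hx]
      _ = (h : Equiv.Perm Ω) ((k : Equiv.Perm Ω) x) :=
          Equiv.congr_fun (habelian k k.2 h h.2) x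
  exact hzh ▸ h.2
end

section
/- Let Γ be a digraph on a vertex set V, let f : V → I be a surjection onto a finite index set, with blocks the fibers f⁻¹(i), and let Γ₀ be the graph on I in which distinct i, j are adjacent if and only if f⁻¹(i) ≁ f⁻¹(j). Let ≈ be the equivalence relation on I defined by: i ≈ j iff i = j or there is a path from i to j in Γ₀. Let α : V → V be a bijection such that f(α(v)) = f(v) for all v ∈ V (so α fixes every block setwise), and such that for every ≈-equivalence class c ⊆ I there exists an automorphism η_c of Γ with α(v) = η_c(v) for all v ∈ f⁻¹(c). Then α is an automorphism of Γ. -/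
/-- If `A ∼ B`, all pairs in `A × B` agree on being an edge. -/
theorem DigraphSim.edge_iff {V : Type*} {E : V → V → Prop} {A B : Set V}
    (h : DigraphSim E A B) {a b a' b' : V} (ha : a ∈ A) (hb : b ∈ B) (ha' : a' ∈ A)
    (hb' : b' ∈ B) : E a b ↔ E a' b' := by
  rcases h with h | h | h | h <;>
    have h₁ := h a ha b hb <;> have h₂ := h a' ha' b' hb' <;> tauto

/-- Gluing lemma (paper, Lemma 6): let the blocks be the fibers of `f : V → I`, let `Γ₀`
be the graph on `I` with `i ~ j` iff `f⁻¹(i) ≁ f⁻¹(j)`, and let `≈` be the connectivity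
equivalence relation of `Γ₀`.  If a bijection `α` of `V` fixes every block setwise and
agrees on (the union of the blocks of) each `≈`-class with some automorphism of `Γ`,
then `α` is an automorphism of `Γ`. -/
theorem glue_automorphism {V I : Type*} [Finite I]
    (E : V → V → Prop) (f : V → I) (hf : Function.Surjective f)
    (α : V ≃ V)
    (hfix : ∀ v : V, f (α v) = f v)
    (hclass : ∀ i : I, ∃ η : V ≃ V, (∀ x y : V, E x y ↔ E (η x) (η y)) ∧
      ∀ v : V,
        Relation.ReflTransGen
          (fun i' j' : I => i' ≠ j' ∧ ¬ DigraphSim E (f ⁻¹' {i'}) (f ⁻¹' {j'}))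
          (f v) i →
        α v = η v) :
    ∀ x y : V, E x y ↔ E (α x) (α y) := by
  intro x y
  have glue (h : Relation.ReflTransGen
      (fun i' j' : I => i' ≠ j' ∧ ¬ DigraphSim E (f ⁻¹' {i'}) (f ⁻¹' {j'})) (f x) (f y)) :
      E x y ↔ E (α x) (α y) := by
    obtain ⟨η, hη, hαη⟩ := hclass (f y)
    rw [hαη x h, hαη y .refl]
    exact hη x y
  by_cases hxy : f x = f y
  · exact glue (hxy ▸ .refl)
  by_cases hs : DigraphSim E (f ⁻¹' {f x}) (f ⁻¹' {f y})
  · exact hs.edge_iff rfl rfl (hfix x) (hfix y)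
  · exact glue (.single ⟨hxy, hs⟩)
end

section
/- Let q be a prime, V a set, and ι_A, ι_B : ℤ/qℤ → V injections with disjoint images A and B. Let ĝ, g̊, ŵ, ẘ be bijections of V such that: ĝ(ι_A(x)) = ι_A(x+1), ĝ(ι_B(x)) = ι_B(x+1), g̊(ι_A(x)) = ι_A(x+1), and g̊(ι_B(x)) = ι_B(x+d) for all x ∈ ℤ/qℤ, where d ∈ ℤ/qℤ; ŵ(A) = B and ẘ(A) = B; ŵ commutes with ĝ; and ẘ commutes with g̊. Then the bijection α = ẘ ∘ ŵ⁻¹ satisfies (α⁻¹ ∘ g̊ ∘ α)(ι_B(x)) = ι_B(x+1) for all x ∈ ℤ/qℤ. -/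
/-- Lemma (paper, Lemma 7(a)): with `A`, `B` disjoint copies of `ℤ/qℤ` inside `V`, if
`ĝ` shifts both copies by `1`, `g̊` shifts `A` by `1` and `B` by `d`, `ŵ(A) = B = ẘ(A)`,
`ŵ` commutes with `ĝ` and `ẘ` commutes with `g̊`, then `α = ẘ ∘ ŵ⁻¹` conjugates `g̊`
to the shift by `1` on `B`. -/
theorem conjugate_shift_on_B (q : ℕ) (hq : q.Prime) {V : Type*}
    (ιA ιB : ZMod q → V) (hιA : Function.Injective ιA) (hιB : Function.Injective ιB)
    (hdisj : Disjoint (Set.range ιA) (Set.range ιB))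
    (ghat gring what wring : Equiv.Perm V) (d : ZMod q)
    (hghatA : ∀ x : ZMod q, ghat (ιA x) = ιA (x + 1))
    (hghatB : ∀ x : ZMod q, ghat (ιB x) = ιB (x + 1))
    (hgringA : ∀ x : ZMod q, gring (ιA x) = ιA (x + 1))
    (hgringB : ∀ x : ZMod q, gring (ιB x) = ιB (x + d))
    (hwhat : what '' (Set.range ιA) = Set.range ιB)
    (hwring : wring '' (Set.range ιA) = Set.range ιB)
    (hcomm_hat : ∀ v : V, what (ghat v) = ghat (what v))
    (hcomm_ring : ∀ v : V, wring (gring v) = gring (wring v)) :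
    ∀ x : ZMod q,
      (what.symm.trans (wring.trans (gring.trans (wring.symm.trans what)))) (ιB x)
        = ιB (x + 1) := by
  intro x
  obtain ⟨_, ⟨a, rfl⟩, ha⟩ : ιB x ∈ what '' Set.range ιA := hwhat ▸ Set.mem_range_self x
  simp only [Equiv.trans_apply]
  rw [← hghatB, ← ha, Equiv.symm_apply_apply, ← hcomm_ring, Equiv.symm_apply_apply, hgringA,
    ← hghatA, hcomm_hat]
end

section
/- Let q be a prime, V a set, and ι_A, ι_B, ι_C : ℤ/qℤ → V injections with images A, B, C, where A is disjoint from B and from C. Let ĝ, g̊, ŵ, v̊ be bijections of V such that: ĝ(ι_A(x)) = ι_A(x+1), ĝ(ι_B(x)) = ι_B(x+1), ĝ(ι_C(x)) = ι_C(x+1), g̊(ι_A(x)) = ι_A(x+1), g̊(ι_B(x)) = ι_B(x+d), and g̊(ι_C(x)) = ι_C(x+d) for all x ∈ ℤ/qℤ, where d ∈ ℤ/qℤ; ŵ(A) = B and ŵ commutes with ĝ; v̊(A) = C and v̊ commutes with g̊. Then the bijection β = v̊ ∘ ŵ⁻¹ satisfies (β⁻¹ ∘ g̊ ∘ β)(ι_B(x))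 = ι_B(x+1) for all x ∈ ℤ/qℤ. -/
/-- Lemma (paper, Lemma 7(b)): with `A`, `B`, `C` copies of `ℤ/qℤ` inside `V`, `A`
disjoint from `B` and from `C`, if `ĝ` shifts all three copies by `1`, `g̊` shifts `A`
by `1` and `B`, `C` by `d`, `ŵ(A) = B` with `ŵ` commuting with `ĝ`, and `v̊(A) = C`
with `v̊` commuting with `g̊`, then `β = v̊ ∘ ŵ⁻¹` conjugates `g̊` to the shift by `1`
on `B`. -/
theorem conjugate_shift_on_B' (q : ℕ) (hq : q.Prime) {V : Type*}
    (ιA ιB ιC : ZMod q → V)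
    (hιA : Function.Injective ιA) (hιB : Function.Injective ιB)
    (hιC : Function.Injective ιC)
    (hAB : Disjoint (Set.range ιA) (Set.range ιB))
    (hAC : Disjoint (Set.range ιA) (Set.range ιC))
    (ghat gring what vring : Equiv.Perm V) (d : ZMod q)
    (hghatA : ∀ x : ZMod q, ghat (ιA x) = ιA (x + 1))
    (hghatB : ∀ x : ZMod q, ghat (ιB x) = ιB (x + 1))
    (hghatC : ∀ x : ZMod q, ghat (ιC x) = ιC (x + 1))
    (hgringA : ∀ x : ZMod q, gring (ιA x) = ιA (x + 1))
    (hgringB : ∀ x : ZMod q, gring (ιB x) = ιB (x + d))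
    (hgringC : ∀ x : ZMod q, gring (ιC x) = ιC (x + d))
    (hwhat : what '' (Set.range ιA) = Set.range ιB)
    (hvring : vring '' (Set.range ιA) = Set.range ιC)
    (hcomm_hat : ∀ v : V, what (ghat v) = ghat (what v))
    (hcomm_ring : ∀ v : V, vring (gring v) = gring (vring v)) :
    ∀ x : ZMod q,
      (what.symm.trans (vring.trans (gring.trans (vring.symm.trans what)))) (ιB x)
        = ιB (x + 1) := by
  intro x
  obtain ⟨_, ⟨a, rfl⟩, ha⟩ : ιB x ∈ what '' Set.range ιA := hwhat ▸ Set.mem_range_self x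
  simp only [Equiv.trans_apply]
  rw [← ha, Equiv.symm_apply_apply, ← hcomm_ring, Equiv.symm_apply_apply, hgringA,
    ← hghatA, hcomm_hat, ha, hghatB]
end

section
/- Let p be a prime and let Γ be a digraph on (ℤ/pℤ)³. For a, b ∈ ℤ/pℤ set E_{a,b} = {(a,b,c) : c ∈ ℤ/pℤ}. Suppose the permutations z : (a,b,c) ↦ (a,b,c+1) and h₁ : (a,b,c) ↦ (a,b+1,c) are automorphisms of Γ, and suppose t : (ℤ/pℤ)² → ℤ/pℤ is a function such that h₂ : (a,b,c) ↦ (a,b+1,c+t(a,b)) is also an automorphism of Γ. Then for all a, a', b, b' ∈ ℤ/pℤ with a ≠ a', either E_{a,b} ∼ E_{a',b'}, or t(a,b+n) = t(a',b'+n) for all n ∈ ℤ/pℤ. -/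
/-- A predicate on `ℤ/pℤ` invariant under translation by a nonzero element is constant. -/
theorem ZMod.iff_of_add_invariant {p : ℕ} [Fact p.Prime] {d : ZMod p} (hd : d ≠ 0)
    {Q : ZMod p → Prop} (hQ : ∀ x, Q x ↔ Q (x + d)) (x y : ZMod p) : Q x ↔ Q y := by
  have iterate : ∀ m : ℕ, Q x ↔ Q (x + m * d) := by
    intro m
    induction m with
    | zero => simp
    | succ m ih =>
      rw [ih, hQ, Nat.cast_succ, add_one_mul, add_assoc]
  have h := iterate ((y - x) / d).val
  rwa [ZMod.natCast_zmod_val, div_mul_cancel₀ _ hd, add_sub_cancel] at h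

/-- Adjacency from one block to another depends only on the pair of blocks, as soon as the values
of `t` differ at some common translate of the two blocks. -/
theorem adj_iff_of_t_ne {p : ℕ} [Fact p.Prime]
    {E : (ZMod p × ZMod p × ZMod p) → (ZMod p × ZMod p × ZMod p) → Prop}
    (hz : ∀ x y : ZMod p × ZMod p × ZMod p,
      E x y ↔ E (x.1, x.2.1, x.2.2 + 1) (y.1, y.2.1, y.2.2 + 1))
    (hh1 : ∀ x y : ZMod p × ZMod p × ZMod p,
      E x y ↔ E (x.1, x.2.1 + 1, x.2.2) (y.1, y.2.1 + 1, y.2.2))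
    {t : ZMod p × ZMod p → ZMod p}
    (hh2 : ∀ x y : ZMod p × ZMod p × ZMod p,
      E x y ↔ E (x.1, x.2.1 + 1, x.2.2 + t (x.1, x.2.1))
               (y.1, y.2.1 + 1, y.2.2 + t (y.1, y.2.1)))
    {a a' b b' n : ZMod p} (ht : t (a, b + n) ≠ t (a', b' + n)) (c c' e e' : ZMod p) :
    E (a, b, c) (a', b', c') ↔ E (a, b, e) (a', b', e') := by
  have shift_z (c c' k : ZMod p) :
      E (a, b, c) (a', b', c') ↔ E (a, b, c + k) (a', b', c' + k) := by
    simpa using ZMod.iff_of_add_invariant one_ne_zero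
      (Q := fun k ↦ E (a, b, c + k) (a', b', c' + k))
      (fun k ↦ by simpa [add_assoc] using hz (a, b, c + k) (a', b', c' + k)) 0 k
  have shift_h (c c' k : ZMod p) :
      E (a, b, c) (a', b', c') ↔ E (a, b + k, c) (a', b' + k, c') := by
    simpa using ZMod.iff_of_add_invariant one_ne_zero
      (Q := fun k ↦ E (a, b + k, c) (a', b' + k, c'))
      (fun k ↦ by simpa [add_assoc] using hh1 (a, b + k, c) (a', b' + k, c')) 0 k
  have shift_d (x : ZMod p) : E (a, b, e) (a', b', x) ↔
      E (a, b, e) (a', b', x + (t (a', b' + n) - t (a, b + n))) := by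
    rw [shift_h e x n, hh2,
      ← hh1 (a, b + n, e + t (a, b + n)) (a', b' + n, x + t (a', b' + n)), ← shift_h,
      shift_z _ _ (-t (a, b + n)), add_neg_cancel_right, add_assoc, ← sub_eq_add_neg]
  rw [shift_z c c' (e - c), add_sub_cancel]
  exact ZMod.iff_of_add_invariant (sub_ne_zero.mpr ht.symm) shift_d _ _

/-- Lemma (paper, Lemma on the sets `E_{a,b}`): if `z : (a,b,c) ↦ (a,b,c+1)`,
`h₁ : (a,b,c) ↦ (a,b+1,c)` and `h₂ : (a,b,c) ↦ (a,b+1,c+t(a,b))` are automorphisms of a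
digraph on `(ℤ/pℤ)³`, then for `a ≠ a'` either `E_{a,b} ∼ E_{a',b'}` or
`t(a,b+n) = t(a',b'+n)` for all `n`. -/
theorem sim_or_t_eq (p : ℕ) (hp : p.Prime)
    (E : (ZMod p × ZMod p × ZMod p) → (ZMod p × ZMod p × ZMod p) → Prop)
    (hz : ∀ x y : ZMod p × ZMod p × ZMod p,
      E x y ↔ E (x.1, x.2.1, x.2.2 + 1) (y.1, y.2.1, y.2.2 + 1))
    (hh1 : ∀ x y : ZMod p × ZMod p × ZMod p,
      E x y ↔ E (x.1, x.2.1 + 1, x.2.2) (y.1, y.2.1 + 1, y.2.2))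
    (t : ZMod p × ZMod p → ZMod p)
    (hh2 : ∀ x y : ZMod p × ZMod p × ZMod p,
      E x y ↔ E (x.1, x.2.1 + 1, x.2.2 + t (x.1, x.2.1))
               (y.1, y.2.1 + 1, y.2.2 + t (y.1, y.2.1))) :
    ∀ a a' b b' : ZMod p, a ≠ a' →
      DigraphSim E {v : ZMod p × ZMod p × ZMod p | v.1 = a ∧ v.2.1 = b}
        {v : ZMod p × ZMod p × ZMod p | v.1 = a' ∧ v.2.1 = b'} ∨
      ∀ n : ZMod p, t (a, b + n) = t (a', b' + n) := by
  have : Fact p.Prime := ⟨hp⟩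
  intro a a' b b' _
  rw [or_iff_not_imp_right, not_forall]
  rintro ⟨n, hn⟩
  have forward (c c' : ZMod p) := adj_iff_of_t_ne hz hh1 hh2 hn c c' 0 0
  have backward (c c' : ZMod p) := adj_iff_of_t_ne hz hh1 hh2 (Ne.symm hn) c c' 0 0
  simp only [DigraphSim, Set.mem_ofPred_eq, Prod.forall, and_imp]
  by_cases h : E (a, b, 0) (a', b', 0) <;> by_cases h' : E (a', b', 0) (a, b, 0)
  · right; right; left
    rintro _ _ c rfl rfl _ _ c' rfl rfl
    exact ⟨(forward c c').mpr h, (backward c' c).mpr h'⟩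
  · left
    rintro _ _ c rfl rfl _ _ c' rfl rfl
    exact ⟨(forward c c').mpr h, mt (backward c' c).mp h'⟩
  · right; left
    rintro _ _ c rfl rfl _ _ c' rfl rfl
    exact ⟨(backward c' c).mpr h', mt (forward c c').mp h⟩
  · right; right; right
    rintro _ _ c rfl rfl _ _ c' rfl rfl
    exact ⟨mt (forward c c').mp h, mt (backward c' c).mp h'⟩
end

section
/- Let p be a prime and t : (ℤ/pℤ)² → ℤ/pℤ a function; define permutations of (ℤ/pℤ)³ by z : (a,b,c) ↦ (a,b,c+1) and h₂ : (a,b,c) ↦ (a,b+1,c+t(a,b)). Let a, b, a', b' ∈ ℤ/pℤ satisfy t(a,b+n) = t(a',b'+n) for all n ∈ ℤ/pℤ, and let k be a permutation of (ℤ/pℤ)³ commuting with both z and h₂ such that k(a,b,0) = (a',b',0). Then k(a,b+d,e) = (a',b'+d,e) for all d, e ∈ ℤ/pℤ. -/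
/-- A property of residues mod `n` that holds at `0` and is preserved by `x ↦ x + 1`
holds everywhere. -/
theorem ZMod.induction_add_one {n : ℕ} [NeZero n] {P : ZMod n → Prop} (h0 : P 0)
    (hs : ∀ x, P x → P (x + 1)) (x : ZMod n) : P x := by
  have h : ∀ m : ℕ, P m := by
    intro m
    induction m with
    | zero => simpa using h0
    | succ m ih => simpa using hs _ ih
  simpa using h x.val

/-- Lemma (paper, Lemma 8): if a permutation `k` of `(ℤ/pℤ)³` commutes with
`z : (a,b,c) ↦ (a,b,c+1)` and with `h₂ : (a,b,c) ↦ (a,b+1,c+t(a,b))`, maps `(a,b,0)` to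
`(a',b',0)`, and `t(a,b+n) = t(a',b'+n)` for all `n`, then `k(a,b+d,e) = (a',b'+d,e)`
for all `d, e`. -/
theorem translate_blocks (p : ℕ) (hp : p.Prime)
    (t : ZMod p × ZMod p → ZMod p)
    (k : Equiv.Perm (ZMod p × ZMod p × ZMod p))
    (hkz : ∀ v : ZMod p × ZMod p × ZMod p,
      k (v.1, v.2.1, v.2.2 + 1) = ((k v).1, (k v).2.1, (k v).2.2 + 1))
    (hkh2 : ∀ v : ZMod p × ZMod p × ZMod p,
      k (v.1, v.2.1 + 1, v.2.2 + t (v.1, v.2.1))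
        = ((k v).1, (k v).2.1 + 1, (k v).2.2 + t ((k v).1, (k v).2.1)))
    (a b a' b' : ZMod p)
    (ht : ∀ n : ZMod p, t (a, b + n) = t (a', b' + n))
    (hk0 : k (a, b, 0) = (a', b', 0)) :
    ∀ d e : ZMod p, k (a, b + d, e) = (a', b' + d, e) := by
  have : NeZero p := ⟨hp.ne_zero⟩
  intro d
  induction d using ZMod.induction_add_one with
  | h0 =>
    intro e
    induction e using ZMod.induction_add_one with
    | h0 => simpa using hk0
    | hs e ih => simpa only [ih] using hkz (a, b + 0, e)
  | hs d ih =>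
    intro e
    have h := hkh2 (a, b + d, e - t (a, b + d))
    simpa [ih, ← ht, add_assoc] using h
end

section
/- Let p be a prime and t : (ℤ/pℤ)² → ℤ/pℤ a function; define permutations of (ℤ/pℤ)³ by z : (a,b,c) ↦ (a,b,c+1), h₁ : (a,b,c) ↦ (a,b+1,c), and h₂ : (a,b,c) ↦ (a,b+1,c+t(a,b)). Let a, b, a', b' ∈ ℤ/pℤ satisfy t(a,b+n) = t(a',b'+n) for all n ∈ ℤ/pℤ. Let k₂ be a permutation of (ℤ/pℤ)³ commuting with z and h₂ with k₂(a,b,0) = (a',b',0), and let k₁ be a permutation of (ℤ/pℤ)³ commuting with z and h₁ with k₁(a,b,0) = (a',b',0). Then k₁ and k₂ agree on E_{a,b} = {(a,b,c) : c ∈ ℤ/pℤ}; in fact k₁(a,b,c) = k₂(a,b,c) = (a',b',c) for all c ∈ ℤ/pℤ. -/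
/-- A self-map of `A × B × ZMod p` commuting with `(a, b, c) ↦ (a, b, c + 1)` is determined on
the fibre over `(a, b)` by its value at `(a, b, 0)`. -/
theorem map_fibre_of_commute_add_one {A B : Type*} {p : ℕ} [NeZero p]
    (k : A × B × ZMod p → A × B × ZMod p)
    (hk : ∀ v, k (v.1, v.2.1, v.2.2 + 1) = ((k v).1, (k v).2.1, (k v).2.2 + 1))
    {a a' : A} {b b' : B} (h0 : k (a, b, 0) = (a', b', 0)) (c : ZMod p) :
    k (a, b, c) = (a', b', c) := by
  have key : ∀ n : ℕ, k (a, b, (n : ZMod p)) = (a', b', (n : ZMod p)) := by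
    intro n
    induction n with
    | zero => simpa using h0
    | succ n ih => simpa [ih] using hk (a, b, (n : ZMod p))
  simpa using key c.val

/-- Corollary (paper, Corollary 1): with `z : (a,b,c) ↦ (a,b,c+1)`,
`h₁ : (a,b,c) ↦ (a,b+1,c)`, `h₂ : (a,b,c) ↦ (a,b+1,c+t(a,b))` and
`t(a,b+n) = t(a',b'+n)` for all `n`, if `k₂` commutes with `z` and `h₂`, `k₁` commutes
with `z` and `h₁`, and both map `(a,b,0)` to `(a',b',0)`, then `k₁` and `k₂` agree on
`E_{a,b}`, both sending `(a,b,c)` to `(a',b',c)`. -/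
theorem restrictions_agree (p : ℕ) (hp : p.Prime)
    (t : ZMod p × ZMod p → ZMod p)
    (k₁ k₂ : Equiv.Perm (ZMod p × ZMod p × ZMod p))
    (hk₁z : ∀ v : ZMod p × ZMod p × ZMod p,
      k₁ (v.1, v.2.1, v.2.2 + 1) = ((k₁ v).1, (k₁ v).2.1, (k₁ v).2.2 + 1))
    (hk₁h1 : ∀ v : ZMod p × ZMod p × ZMod p,
      k₁ (v.1, v.2.1 + 1, v.2.2) = ((k₁ v).1, (k₁ v).2.1 + 1, (k₁ v).2.2))
    (hk₂z : ∀ v : ZMod p × ZMod p × ZMod p,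
      k₂ (v.1, v.2.1, v.2.2 + 1) = ((k₂ v).1, (k₂ v).2.1, (k₂ v).2.2 + 1))
    (hk₂h2 : ∀ v : ZMod p × ZMod p × ZMod p,
      k₂ (v.1, v.2.1 + 1, v.2.2 + t (v.1, v.2.1))
        = ((k₂ v).1, (k₂ v).2.1 + 1, (k₂ v).2.2 + t ((k₂ v).1, (k₂ v).2.1)))
    (a b a' b' : ZMod p)
    (ht : ∀ n : ZMod p, t (a, b + n) = t (a', b' + n))
    (hk₁0 : k₁ (a, b, 0) = (a', b', 0))
    (hk₂0 : k₂ (a, b, 0) = (a', b', 0)) :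
    ∀ c : ZMod p, k₁ (a, b, c) = (a', b', c) ∧ k₂ (a, b, c) = (a', b', c) := by
  have : NeZero p := ⟨hp.ne_zero⟩
  exact fun c => ⟨map_fibre_of_commute_add_one k₁ hk₁z hk₁0 c,
    map_fibre_of_commute_add_one k₂ hk₂z hk₂0 c⟩
end

section
/- Let p and q be distinct primes and V = (ℤ/pℤ)³ × ℤ/qℤ. Let W ≤ Sym(V) be the subgroup of all permutations π for which there exist a permutation σ of (ℤ/pℤ)³ and a function f : (ℤ/pℤ)³ → ℤ/qℤ with π(v,x) = (σ(v), x + f(v)) for all (v,x) ∈ V (the imprimitive wreath product ℤ/qℤ ≀ Sym(p³)). Let P be a p-subgroup of Sym(V) with P ≤ W such that for every w ∈ (ℤ/pℤ)³ the translation (v,x) ↦ (v+w, x) belongs to P. Then every π ∈ P has trivial base part: there is a permutation σ of (ℤ/pℤ)³ with π(v,x) = (σ(v), x) for all (v,x) ∈ V. -/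
/-- A permutation acting on the fibre over `v` as the translation by `c` acts there, after
`k` iterations, as the translation by `k * c`. -/
theorem perm_pow_apply_of_translation {α R : Type*} [Semiring R] {ρ : Equiv.Perm (α × R)}
    {v : α} {c : R} (h : ∀ y, ρ (v, y) = (v, y + c)) (k : ℕ) (y : R) :
    (ρ ^ k) (v, y) = (v, y + k * c) := by
  induction k with
  | zero => simp
  | succ k ih =>
    rw [pow_succ', Equiv.Perm.mul_apply, ih, h, Nat.cast_succ, add_one_mul, add_assoc]

/-- A permutation of `p`-power order that preserves a fibre `ZMod q`, `q ≠ p`, and acts on it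
as a translation acts on it trivially. -/
theorem eq_zero_of_perm_pow_eq_one {α : Type*} {p q : ℕ} (hp : p.Prime) (hq : q.Prime)
    (hpq : p ≠ q) {ρ : Equiv.Perm (α × ZMod q)} {v : α} {c : ZMod q}
    (h : ∀ y, ρ (v, y) = (v, y + c)) {n : ℕ} (hρ : ρ ^ p ^ n = 1) : c = 0 := by
  have hunit : IsUnit ((p ^ n : ℕ) : ZMod q) :=
    (ZMod.isUnit_iff_coprime _ _).2 (((Nat.coprime_primes hp hq).2 hpq).pow_left n)
  have hfibre := perm_pow_apply_of_translation h (p ^ n) 0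
  rw [hρ, Equiv.Perm.one_apply, zero_add, Prod.mk.injEq] at hfibre
  exact hunit.mul_right_eq_zero.1 hfibre.2.symm


/-- Lemma (paper, Lemma 10(b)): let `V = (ℤ/pℤ)³ × ℤ/qℤ` with `p ≠ q` primes, and let
`W ≤ Sym(V)` be the imprimitive wreath product `ℤ/qℤ ≀ Sym(p³)` (permutations of the form
`(v,x) ↦ (σ v, x + f v)`).  If `P` is a `p`-subgroup of `Sym(V)` contained in `W` and
containing all translations `(v,x) ↦ (v+w, x)`, then every element of `P` has trivial
base part. -/
theorem trivial_base_part (p q : ℕ) (hp : p.Prime) (hq : q.Prime) (hpq : p ≠ q)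
    (W : Subgroup (Equiv.Perm ((ZMod p × ZMod p × ZMod p) × ZMod q)))
    (hW : ∀ π : Equiv.Perm ((ZMod p × ZMod p × ZMod p) × ZMod q),
      π ∈ W ↔ ∃ (σ : Equiv.Perm (ZMod p × ZMod p × ZMod p))
        (f : ZMod p × ZMod p × ZMod p → ZMod q),
        ∀ (v : ZMod p × ZMod p × ZMod p) (x : ZMod q), π (v, x) = (σ v, x + f v))
    (P : Subgroup (Equiv.Perm ((ZMod p × ZMod p × ZMod p) × ZMod q)))
    (hPp : IsPGroup p P) (hPW : P ≤ W)
    (htrans : ∀ w : ZMod p × ZMod p × ZMod p, ∃ π ∈ P,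
      ∀ (v : ZMod p × ZMod p × ZMod p) (x : ZMod q), π (v, x) = (v + w, x)) :
    ∀ π ∈ P, ∃ σ : Equiv.Perm (ZMod p × ZMod p × ZMod p),
      ∀ (v : ZMod p × ZMod p × ZMod p) (x : ZMod q), π (v, x) = (σ v, x) := by
  intro π hπ
  obtain ⟨σ, f, hσ⟩ := (hW π).1 (hPW hπ)
  refine ⟨σ, fun v x => ?_⟩
  obtain ⟨τ, hτ, hτv⟩ := htrans (v - σ v)
  have hfix : ∀ y : ZMod q, (τ * π) (v, y) = (v, y + f v) := fun y => by
    rw [Equiv.Perm.mul_apply, hσ, hτv, add_sub_cancel]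
  obtain ⟨n, hn⟩ := hPp ⟨τ * π, P.mul_mem hτ hπ⟩
  have hpow : (τ * π) ^ p ^ n = 1 := congrArg Subtype.val hn
  rw [hσ, eq_zero_of_perm_pow_eq_one hp hq hpq hfix hpow, add_zero]
end

section
/- Let p and q be primes, V = (ℤ/pℤ)³ × ℤ/qℤ, and Γ a digraph on V. For v ∈ (ℤ/pℤ)³ set B_v = {v} × ℤ/qℤ, and let Γ₀ be the graph on (ℤ/pℤ)³ in which distinct v, v' are adjacent if and only if B_v ≁ B_{v'}. Suppose ĝ : (v,x) ↦ (v, x+1) is an automorphism of Γ, and g̊ is an automorphism of Γ of the form g̊(v,x) = (v, x + d(v)) for a function d : (ℤ/pℤ)³ → ℤ/qℤ with d(v₀) = 1 for some v₀ ∈ (ℤ/pℤ)³. If Γ₀ is connected, then g̊ = ĝ, i.e. d(v) = 1 for all v ∈ (ℤ/pℤ)³. -/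
/-- A binary relation on `ZMod q`, `q` prime, invariant under translation by `(1, 1)` and by
`(a, b)` with `a ≠ b` is constant. -/
theorem ZMod.iff_of_translation_invariant {q : ℕ} [Fact q.Prime] (P : ZMod q → ZMod q → Prop)
    (h1 : ∀ x y, P x y ↔ P (x + 1) (y + 1)) {a b : ZMod q} (hab : a ≠ b)
    (h2 : ∀ x y, P x y ↔ P (x + a) (y + b)) (x y x' y' : ZMod q) : P x y ↔ P x' y' := by
  have diagNat : ∀ (n : ℕ) x y, P x y ↔ P (x + n) (y + n) := by
    intro n
    induction n with
    | zero => simp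
    | succ n ih =>
      intro x y
      rw [ih, h1]
      simp only [Nat.cast_succ, add_assoc]
  have diag : ∀ t x y, P x y ↔ P (x + t) (y + t) := by
    intro t x y
    have := diagNat t.val x y
    rwa [ZMod.natCast_zmod_val] at this
  have shift : ∀ x y, P x y ↔ P x (y + (b - a)) := by
    intro x y
    rw [h2, diag (-a)]
    ring_nf
  have shiftNat : ∀ (n : ℕ) x y, P x y ↔ P x (y + n * (b - a)) := by
    intro n
    induction n with
    | zero => simp
    | succ n ih =>
      intro x y
      rw [ih, shift]
      push_cast
      ring_nf
  have vert : ∀ x y y', P x y ↔ P x y' := by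
    intro x y y'
    have h := shiftNat ((y' - y) / (b - a)).val x y
    rwa [ZMod.natCast_zmod_val, div_mul_cancel₀ _ (sub_ne_zero.2 hab.symm),
      add_sub_cancel] at h
  rw [diag (x' - x), add_sub_cancel]
  exact vert _ _ _

/-- Two blocks that an automorphism `(v, x) ↦ (v, x + d v)` translates by different amounts are
related by `∼`. -/
theorem DigraphSim.of_translation_invariant {ι : Type*} {q : ℕ} [Fact q.Prime]
    (E : ι × ZMod q → ι × ZMod q → Prop)
    (h1 : ∀ x y : ι × ZMod q, E x y ↔ E (x.1, x.2 + 1) (y.1, y.2 + 1)) (d : ι → ZMod q)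
    (h2 : ∀ x y : ι × ZMod q, E x y ↔ E (x.1, x.2 + d x.1) (y.1, y.2 + d y.1))
    {u w : ι} (hd : d u ≠ d w) :
    DigraphSim E {z : ι × ZMod q | z.1 = u} {z : ι × ZMod q | z.1 = w} := by
  have forward : ∀ x y, E (u, x) (w, y) ↔ E (u, 0) (w, 0) := fun x y =>
    ZMod.iff_of_translation_invariant (fun x y => E (u, x) (w, y))
      (fun x y => h1 (u, x) (w, y)) hd (fun x y => h2 (u, x) (w, y)) x y 0 0
  have backward : ∀ x y, E (w, y) (u, x) ↔ E (w, 0) (u, 0) := fun x y =>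
    ZMod.iff_of_translation_invariant (fun y x => E (w, y) (u, x))
      (fun y x => h1 (w, y) (u, x)) hd.symm (fun y x => h2 (w, y) (u, x)) y x 0 0
  simp only [DigraphSim, Set.mem_ofPred_eq, Prod.forall]
  by_cases hf : E (u, 0) (w, 0) <;> by_cases hb : E (w, 0) (u, 0)
  · right; right; left
    rintro _ x rfl _ y rfl
    simp [forward, backward, hf, hb]
  · left
    rintro _ x rfl _ y rfl
    simp [forward, backward, hf, hb]
  · right; left
    rintro _ x rfl _ y rfl
    simp [forward, backward, hf, hb]
  · right; right; right
    rintro _ x rfl _ y rfl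
    simp [forward, backward, hf, hb]

/-- (Paper, Step 2, connected case): let `Γ` be a digraph on `V = (ℤ/pℤ)³ × ℤ/qℤ`, with
blocks `B_v = {v} × ℤ/qℤ` and block graph `Γ₀` (`v ~ v'` iff `B_v ≁ B_{v'}`).  If
`ĝ : (v,x) ↦ (v,x+1)` and `g̊ : (v,x) ↦ (v, x + d(v))` are automorphisms of `Γ`,
`d(v₀) = 1` for some `v₀`, and `Γ₀` is connected, then `d ≡ 1`, i.e. `g̊ = ĝ`. -/
theorem connected_implies_equal (p q : ℕ) (hp : p.Prime) (hq : q.Prime)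
    (E : ((ZMod p × ZMod p × ZMod p) × ZMod q) →
         ((ZMod p × ZMod p × ZMod p) × ZMod q) → Prop)
    (hghat : ∀ x y : (ZMod p × ZMod p × ZMod p) × ZMod q,
      E x y ↔ E (x.1, x.2 + 1) (y.1, y.2 + 1))
    (d : ZMod p × ZMod p × ZMod p → ZMod q)
    (hgring : ∀ x y : (ZMod p × ZMod p × ZMod p) × ZMod q,
      E x y ↔ E (x.1, x.2 + d x.1) (y.1, y.2 + d y.1))
    (v₀ : ZMod p × ZMod p × ZMod p) (hd0 : d v₀ = 1)
    (hconn : ∀ v v' : ZMod p × ZMod p × ZMod p,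
      Relation.ReflTransGen
        (fun u w : ZMod p × ZMod p × ZMod p => u ≠ w ∧
          ¬ DigraphSim E {z : (ZMod p × ZMod p × ZMod p) × ZMod q | z.1 = u}
            {z : (ZMod p × ZMod p × ZMod p) × ZMod q | z.1 = w})
        v v') :
    ∀ v : ZMod p × ZMod p × ZMod p, d v = 1 := by
  have : Fact q.Prime := ⟨hq⟩
  intro v
  induction hconn v₀ v with
  | refl => exact hd0
  | tail _ huw ih =>
    by_contra hw
    exact huw.2 (DigraphSim.of_translation_invariant E hghat d hgring
      (ih.trans_ne (Ne.symm hw)))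
end
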